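/- arXiv:math/9603218 — 9 statements merged into one kernel-verified Lean document; each statement's English description precedes it below -/
import Mathlib

section
/- For every complex number a with Re a > 0 and every complex number z, one has Γ(a) · γ*(a,z) = ∫₀^1 u^(a−1) e^(−zu) du, where γ*(a,z) is defined by its everywhere-convergent series. -/
open MeasureTheory

/-- The exponential series of `e^(z (1 - u))`, weighted by `u^(a-1)`, may be integrated
term by term over `[0, 1]`. -/
theorem hasSum_integral_cpow_mul_exp (a : ℂ) (ha : 0 < a.re) (z : ℂ) :
    HasSum
      (fun n : ℕ ↦ ∫ u in (0:ℝ)..1,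
        (u : ℂ) ^ (a - 1) * ((z * (1 - (u : ℂ))) ^ n / (n.factorial : ℂ)))
      (∫ u in (0:ℝ)..1, (u : ℂ) ^ (a - 1) * Complex.exp (z * (1 - (u : ℂ)))) := by
  have hcpow : IntervalIntegrable (fun u : ℝ ↦ (u : ℂ) ^ (a - 1)) volume 0 1 :=
    intervalIntegral.intervalIntegrable_cpow' (by simpa using ha)
  refine intervalIntegral.hasSum_integral_of_dominated_convergence
    (fun n u ↦ ‖(u : ℂ) ^ (a - 1)‖ * (‖z‖ ^ n / (n.factorial : ℝ))) ?_ ?_ ?_ ?_ ?_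
  · intro n
    exact (intervalIntegrable_iff.mp hcpow).aestronglyMeasurable.mul
      (by fun_prop : Continuous fun u : ℝ ↦
        (z * (1 - (u : ℂ))) ^ n / (n.factorial : ℂ)).aestronglyMeasurable
  · refine fun n ↦ Filter.Eventually.of_forall fun u hu ↦ ?_
    rw [Set.uIoc_of_le zero_le_one] at hu
    have h1 : ‖1 - (u : ℂ)‖ ≤ 1 := by
      rw [← Complex.ofReal_one, ← Complex.ofReal_sub, Complex.norm_real, Real.norm_eq_abs, abs_le]
      constructor <;> linarith [hu.1, hu.2]
    rw [norm_mul, norm_div, norm_pow, norm_mul, Complex.norm_natCast]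
    gcongr
    exact mul_le_of_le_one_right (norm_nonneg z) h1
  · exact Filter.Eventually.of_forall fun u _ ↦
      (Real.summable_pow_div_factorial ‖z‖).mul_left _
  · simp_rw [tsum_mul_left]
    exact hcpow.norm.mul_const _
  · refine Filter.Eventually.of_forall fun u _ ↦ HasSum.mul_left _ ?_
    rw [Complex.exp_eq_exp_ℂ]
    exact NormedSpace.expSeries_div_hasSum_exp _

/-- Each term of the integrated series is a beta integral. -/
theorem Gamma_mul_pow_div_Gamma_eq_integral (a : ℂ) (ha : 0 < a.re) (z : ℂ) (n : ℕ) :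
    Complex.Gamma a * (z ^ n / Complex.Gamma (a + n + 1)) =
      ∫ u in (0:ℝ)..1,
        (u : ℂ) ^ (a - 1) * ((z * (1 - (u : ℂ))) ^ n / (n.factorial : ℂ)) := by
  have hn : (n.factorial : ℂ) ≠ 0 := Nat.cast_ne_zero.mpr n.factorial_ne_zero
  have hbeta := Complex.betaIntegral_eq_Gamma_mul_div a (n + 1) ha
    (by simp; positivity)
  rw [Complex.Gamma_nat_eq_factorial, ← add_assoc] at hbeta
  have hterm : ∀ u : ℝ, (u : ℂ) ^ (a - 1) * ((z * (1 - (u : ℂ))) ^ n / (n.factorial : ℂ)) =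
      z ^ n / (n.factorial : ℂ) *
        ((u : ℂ) ^ (a - 1) * (1 - (u : ℂ)) ^ ((n : ℂ) + 1 - 1)) := fun u ↦ by
    rw [add_sub_cancel_right, Complex.cpow_natCast, mul_pow]
    ring
  simp_rw [hterm]
  rw [intervalIntegral.integral_const_mul, ← Complex.betaIntegral, hbeta]
  field_simp

/-- For `Re a > 0` and every complex `z`,
`Γ(a) γ*(a,z) = ∫₀^1 u^(a-1) e^(-z u) du`, where
`γ*(a,z) = e^(-z) ∑_{n=0}^∞ z^n / Γ(a+n+1)`. -/
theorem gammaStar_integral_repr (a : ℂ) (ha : 0 < a.re) (z : ℂ) :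
    Complex.Gamma a *
        (Complex.exp (-z) * ∑' n : ℕ, z ^ n / Complex.Gamma (a + n + 1)) =
      ∫ u in (0:ℝ)..1, (u : ℂ) ^ (a - 1) * Complex.exp (-z * u) := by
  rw [mul_left_comm, ← tsum_mul_left]
  simp_rw [Gamma_mul_pow_div_Gamma_eq_integral a ha z]
  rw [(hasSum_integral_cpow_mul_exp a ha z).tsum_eq, ← intervalIntegral.integral_const_mul]
  congr 1 with u
  rw [mul_left_comm, ← Complex.exp_add]
  ring_nf
end

section
/- For every complex number a with Re a < 1 and every real z > 0, the upper incomplete gamma function satisfies Γ(a, z) = (e^(−z) / Γ(1−a)) · ∫₀^∞ e^(−zt) t^(−a) / (t+1) dt, where Γ(a,z) = ∫_z^∞ t^(a−1) e^(−t) dt. -/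
open MeasureTheory

/-- The kernel `e^(-s) u^(-a) e^(-s u)` is integrable on the product `(z, ∞) × (0, ∞)`. -/
lemma integrable_exp_mul_cpow_mul_exp_prod {a : ℂ} (ha : a.re < 1) {z : ℝ} (hz : 0 < z) :
    Integrable (Function.uncurry fun s u : ℝ ↦
        Complex.exp (-(s : ℂ)) * ((u : ℂ) ^ (-a) * Complex.exp (-(s * u))))
      ((volume.restrict (Set.Ioi z)).prod (volume.restrict (Set.Ioi 0))) := by
  have h_exp : IntegrableOn (fun s : ℝ ↦ Real.exp (-s)) (Set.Ioi z) := integrableOn_exp_neg_Ioi z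
  have h_rpow : IntegrableOn (fun u : ℝ ↦ u ^ (-a.re) * Real.exp (-z * u ^ (1 : ℝ)))
      (Set.Ioi 0) :=
    integrableOn_rpow_mul_exp_neg_mul_rpow (by linarith) one_pos hz
  refine (h_exp.integrable.mul_prod h_rpow.integrable).mono' ?_ ?_
  · apply Measurable.aestronglyMeasurable
    unfold Function.uncurry
    fun_prop
  · rw [Measure.prod_restrict]
    refine ae_restrict_of_forall_mem (measurableSet_Ioi.prod measurableSet_Ioi) ?_
    rintro ⟨s, u⟩ ⟨hs, hu⟩
    simp only [Set.mem_Ioi] at hs hu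
    simp only [Function.uncurry_apply_pair, norm_mul, Complex.norm_exp,
      Complex.norm_cpow_eq_rpow_re_of_pos hu, ← Complex.ofReal_mul, Complex.neg_re,
      Complex.ofReal_re, Real.rpow_one]
    gcongr
    nlinarith

/-- For `Re a < 1` and real `z > 0`,
`Γ(a, z) = (e^(-z) / Γ(1-a)) ∫₀^∞ e^(-z t) t^(-a) / (t+1) dt`,
where `Γ(a,z) = ∫_z^∞ t^(a-1) e^(-t) dt`. -/
theorem upper_incomplete_gamma_repr (a : ℂ) (ha : a.re < 1) (z : ℝ) (hz : 0 < z) :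
    (∫ t in Set.Ioi z, (t : ℂ) ^ (a - 1) * Complex.exp (-(t : ℂ))) =
      Complex.exp (-(z : ℂ)) / Complex.Gamma (1 - a) *
        ∫ t in Set.Ioi (0:ℝ), Complex.exp (-(z : ℂ) * t) * (t : ℂ) ^ (-a) / (t + 1) := by
  have ha' : 0 < (1 - a).re := by simpa using ha
  have h_Gamma : Complex.Gamma (1 - a) ≠ 0 := Complex.Gamma_ne_zero_of_re_pos ha'
  have h_inner_u : ∀ s ∈ Set.Ioi z,
      (∫ u in Set.Ioi (0 : ℝ),
        Complex.exp (-(s : ℂ)) * ((u : ℂ) ^ (-a) * Complex.exp (-(s * u)))) =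
      Complex.Gamma (1 - a) * ((s : ℂ) ^ (a - 1) * Complex.exp (-(s : ℂ))) := by
    intro s hs
    have hs0 : 0 < s := hz.trans hs
    have h := Complex.integral_cpow_mul_exp_neg_mul_Ioi (r := s) ha' (by simpa using hs0)
    rw [show 1 - a - 1 = -a by ring, one_div, Complex.inv_cpow _ _
      (by rw [Complex.arg_ofReal_of_nonneg hs0.le]; exact Real.pi_pos.ne),
      ← Complex.cpow_neg, neg_sub] at h
    rw [integral_const_mul, h]
    ring
  have h_inner_s : ∀ u ∈ Set.Ioi (0 : ℝ),
      (∫ s in Set.Ioi z,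
        Complex.exp (-(s : ℂ)) * ((u : ℂ) ^ (-a) * Complex.exp (-(s * u)))) =
      Complex.exp (-(z : ℂ)) * (Complex.exp (-(z : ℂ) * u) * (u : ℂ) ^ (-a) / (u + 1)) := by
    intro u hu
    rw [Set.mem_Ioi] at hu
    have h := integral_exp_mul_complex_Ioi (a := -((u : ℂ) + 1)) (by simp; linarith) z
    calc _ = ∫ s in Set.Ioi z, (u : ℂ) ^ (-a) * Complex.exp (-((u : ℂ) + 1) * s) := by
          congr 1 with s
          rw [mul_left_comm, ← Complex.exp_add]
          ring_nf
      _ = _ := by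
          rw [integral_const_mul, h, neg_div_neg_eq,
            show -((u : ℂ) + 1) * z = -z + -z * u by ring, Complex.exp_add]
          ring
  have h_swap := integral_integral_swap (integrable_exp_mul_cpow_mul_exp_prod ha hz)
  rw [setIntegral_congr_fun measurableSet_Ioi h_inner_u,
    setIntegral_congr_fun measurableSet_Ioi h_inner_s, integral_const_mul,
    integral_const_mul] at h_swap
  rw [div_mul_eq_mul_div, eq_div_iff h_Gamma, mul_comm, h_swap]
end

section
/- The function η : (0,∞) → ℝ defined by η(λ) = sign(λ−1) · √(2(λ − 1 − ln λ)) is differentiable on (0,∞); its derivative satisfies η′(λ) = (λ−1)/(λ · η(λ)) for every λ > 0 with λ ≠ 1, and η′(1) = 1. -/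
open Filter Topology

lemma tendsto_sub_one_sub_log_div_sq :
    Tendsto (fun l : ℝ => (l - 1 - Real.log l) / (l - 1) ^ 2) (𝓝[≠] 1) (𝓝 (1 / 2)) := by
  have hpos : ∀ᶠ l : ℝ in 𝓝[≠] 1, 0 < l ∧ l ≠ 1 :=
    ((lt_mem_nhds one_pos).filter_mono nhdsWithin_le_nhds).and self_mem_nhdsWithin
  refine HasDerivAt.lhopital_zero_nhdsNE (f' := fun l => 1 - l⁻¹)
    (g' := fun l => 2 * (l - 1)) ?_ ?_ ?_ ?_ ?_ ?_
  · filter_upwards [hpos] with l hl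
    exact ((hasDerivAt_id l).sub_const 1).sub (Real.hasDerivAt_log hl.1.ne')
  · filter_upwards with l
    simpa using ((hasDerivAt_id l).sub_const 1).fun_pow 2
  · filter_upwards [hpos] with l hl
    exact mul_ne_zero two_ne_zero (sub_ne_zero.2 hl.2)
  · have h : ContinuousAt (fun l : ℝ => l - 1 - Real.log l) 1 := by fun_prop (disch := norm_num)
    simpa using h.tendsto.mono_left (nhdsWithin_le_nhds (s := {1}ᶜ))
  · have h : ContinuousAt (fun l : ℝ => (l - 1) ^ 2) 1 := by fun_prop
    simpa using h.tendsto.mono_left (nhdsWithin_le_nhds (s := {1}ᶜ))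
  · have h : ContinuousAt (fun l : ℝ => 1 / (2 * l)) 1 := by fun_prop (disch := norm_num)
    have h' := h.tendsto.mono_left (nhdsWithin_le_nhds (s := {1}ᶜ))
    rw [mul_one] at h'
    refine h'.congr' ?_
    filter_upwards [hpos] with l hl
    have h0 := hl.1.ne'
    have h1 := sub_ne_zero.2 hl.2
    field_simp

lemma hasDerivAt_sign_mul_sqrt_at_one :
    HasDerivAt (fun l : ℝ => Real.sign (l - 1) * √(2 * (l - 1 - Real.log l))) 1 1 := by
  rw [hasDerivAt_iff_tendsto_slope]
  have h := (tendsto_sub_one_sub_log_div_sq.const_mul 2).sqrt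
  rw [mul_one_div_cancel two_ne_zero, Real.sqrt_one] at h
  refine h.congr' ?_
  filter_upwards [self_mem_nhdsWithin] with l hl
  have h1 : l - 1 ≠ 0 := sub_ne_zero.2 hl
  rw [slope_def_field, ← mul_div_assoc, Real.sqrt_div' _ (sq_nonneg _), Real.sqrt_sq_eq_abs]
  rcases h1.lt_or_gt with h | h
  · simp [Real.sign_of_neg h, abs_of_neg h, -neg_sub, div_neg, neg_div]
  · simp [Real.sign_of_pos h, abs_of_pos h]

lemma hasDerivAt_sign_mul_sqrt {l : ℝ} (hl : 0 < l) (hl1 : l ≠ 1) :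
    HasDerivAt (fun x : ℝ => Real.sign (x - 1) * √(2 * (x - 1 - Real.log x)))
      ((l - 1) / (l * (Real.sign (l - 1) * √(2 * (l - 1 - Real.log l))))) l := by
  have hp : 0 < 2 * (l - 1 - Real.log l) := by
    linarith [Real.log_lt_sub_one_of_pos hl hl1]
  have hd : HasDerivAt (fun x : ℝ => √(2 * (x - 1 - Real.log x)))
      (2 * (1 - l⁻¹) / (2 * √(2 * (l - 1 - Real.log l)))) l :=
    ((((hasDerivAt_id l).sub_const 1).sub (Real.hasDerivAt_log hl.ne')).const_mul 2).sqrt hp.ne'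
  have hs : Real.sign (l - 1) * Real.sign (l - 1) = 1 := by
    rcases (sub_ne_zero.2 hl1).lt_or_gt with h | h
    · simp [Real.sign_of_neg h]
    · simp [Real.sign_of_pos h]
  have he : ∀ᶠ x in 𝓝 l, Real.sign (x - 1) = Real.sign (l - 1) := by
    rcases hl1.lt_or_gt with h | h
    · filter_upwards [gt_mem_nhds h] with x hx
      rw [Real.sign_of_neg (sub_neg.2 hx), Real.sign_of_neg (sub_neg.2 h)]
    · filter_upwards [lt_mem_nhds h] with x hx
      rw [Real.sign_of_pos (sub_pos.2 hx), Real.sign_of_pos (sub_pos.2 h)]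
  have hd' := (hd.const_mul (Real.sign (l - 1))).congr_of_eventuallyEq
    (f₁ := fun x : ℝ => Real.sign (x - 1) * √(2 * (x - 1 - Real.log x)))
    (by filter_upwards [he] with x hx; rw [hx])
  refine hd'.congr_deriv ?_
  have hq := (Real.sqrt_pos.2 hp).ne'
  have hs0 : Real.sign (l - 1) ≠ 0 := left_ne_zero_of_mul_eq_one hs
  generalize √(2 * (l - 1 - Real.log l)) = q at *
  generalize Real.sign (l - 1) = s at *
  field_simp
  linear_combination hs


/-- The function `η(λ) = sign(λ-1) √(2(λ - 1 - ln λ))` is differentiable on `(0,∞)`;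
its derivative satisfies `η′(λ) = (λ-1)/(λ η(λ))` for `λ > 0`, `λ ≠ 1`, and `η′(1) = 1`. -/
theorem eta_deriv (η : ℝ → ℝ)
    (hη : ∀ l : ℝ, η l = Real.sign (l - 1) * Real.sqrt (2 * (l - 1 - Real.log l))) :
    (∀ l ∈ Set.Ioi (0:ℝ), DifferentiableAt ℝ η l) ∧
    (∀ l : ℝ, 0 < l → l ≠ 1 → deriv η l = (l - 1) / (l * η l)) ∧
    deriv η 1 = 1 := by
  obtain rfl : η = fun l => Real.sign (l - 1) * √(2 * (l - 1 - Real.log l)) := funext hη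
  refine ⟨fun l hl => ?_, fun l hl hl1 => (hasDerivAt_sign_mul_sqrt hl hl1).deriv,
    hasDerivAt_sign_mul_sqrt_at_one.deriv⟩
  rcases eq_or_ne l 1 with rfl | hl1
  · exact hasDerivAt_sign_mul_sqrt_at_one.differentiableAt
  · exact (hasDerivAt_sign_mul_sqrt hl hl1).differentiableAt
end

section
/- The function η : (0,∞) → ℝ defined by η(λ) = sign(λ−1) · √(2(λ − 1 − ln λ)) is real-analytic on (0,∞); in particular it is real-analytic at the point λ = 1, where (1/2)η(λ)² = λ − 1 − ln λ has a double zero. -/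
open Filter Topology

/-- The square root of a real-analytic function is analytic where the function does not vanish. -/
theorem AnalyticAt.real_sqrt {f : ℝ → ℝ} {x : ℝ} (hf : AnalyticAt ℝ f x) (hx : f x ≠ 0) :
    AnalyticAt ℝ (fun y => Real.sqrt (f y)) x :=
  (Real.contDiffAt_sqrt (n := ⊤) hx).analyticAt.comp hf

/-- If a real-analytic function `f` has a zero of order two at `a`, then its signed square root
`x ↦ sign (x - a) * √(f x)` is analytic at `a`. (If `f` is negative around `a`, the square root
vanishes there by convention.) -/
theorem analyticAt_sign_mul_sqrt {f : ℝ → ℝ} {a : ℝ} (hf : AnalyticAt ℝ f a)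
    (hord : analyticOrderAt f a = 2) :
    AnalyticAt ℝ (fun x => Real.sign (x - a) * Real.sqrt (f x)) a := by
  obtain ⟨g, hg, hga, hfg⟩ := (hf.analyticOrderAt_eq_natCast (n := 2)).1 hord
  refine ((analyticAt_id.sub (analyticAt_const (v := a))).mul (hg.real_sqrt hga)).congr ?_
  filter_upwards [hfg] with x hx
  have habs : Real.sign (x - a) * |x - a| = x - a := by
    rcases lt_trichotomy (x - a) 0 with h | h | h
    · rw [Real.sign_of_neg h, abs_of_neg h]; ring
    · simp [h]
    · rw [Real.sign_of_pos h, abs_of_pos h]; ring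
  simp only [Pi.mul_apply, Pi.sub_apply, id, hx, smul_eq_mul]
  rw [Real.sqrt_mul (sq_nonneg _), Real.sqrt_sq_eq_abs, ← mul_assoc, habs]

theorem analyticAt_two_mul_sub_one_sub_log {x : ℝ} (hx : 0 < x) :
    AnalyticAt ℝ (fun l : ℝ => 2 * (l - 1 - Real.log l)) x :=
  analyticAt_const.mul ((analyticAt_id.sub analyticAt_const).sub (analyticAt_log hx))

theorem hasDerivAt_two_mul_sub_one_sub_log {x : ℝ} (hx : x ≠ 0) :
    HasDerivAt (fun l : ℝ => 2 * (l - 1 - Real.log l)) (2 * (1 - x⁻¹)) x :=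
  (((hasDerivAt_id x).sub_const 1).sub (Real.hasDerivAt_log hx)).const_mul 2

theorem analyticOrderAt_two_mul_sub_one_sub_log :
    analyticOrderAt (fun l : ℝ => 2 * (l - 1 - Real.log l)) 1 = 2 := by
  have hf := analyticAt_two_mul_sub_one_sub_log one_pos
  have hderiv : deriv (fun l : ℝ => 2 * (l - 1 - Real.log l)) =ᶠ[𝓝 1]
      fun x => 2 * (1 - x⁻¹) := by
    filter_upwards [eventually_ne_nhds one_ne_zero] with x hx
    exact (hasDerivAt_two_mul_sub_one_sub_log hx).deriv
  have hderiv₂ : HasDerivAt (fun x : ℝ => 2 * (1 - x⁻¹)) 2 1 := by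
    simpa using ((hasDerivAt_inv (one_ne_zero (α := ℝ))).const_sub 1).const_mul 2
  have hone : analyticOrderAt (deriv (fun l : ℝ => 2 * (l - 1 - Real.log l))) 1 = 1 := by
    refine hf.deriv.analyticOrderAt_eq_one_of_zero_deriv_ne_zero ?_ ?_
    · simp [hderiv.eq_of_nhds]
    · rw [hderiv.deriv_eq, hderiv₂.deriv]; exact two_ne_zero
  have h := hf.analyticOrderAt_deriv_add_one
  rw [hone] at h
  simpa [one_add_one_eq_two] using h.symm

/-- The function `η(λ) = sign(λ-1) √(2(λ - 1 - ln λ))` is real-analytic on `(0,∞)`;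
in particular it is real-analytic at `λ = 1`. -/
theorem eta_analytic (η : ℝ → ℝ)
    (hη : ∀ l : ℝ, η l = Real.sign (l - 1) * Real.sqrt (2 * (l - 1 - Real.log l))) :
    (∀ l ∈ Set.Ioi (0:ℝ), AnalyticAt ℝ η l) ∧ AnalyticAt ℝ η 1 := by
  suffices h : ∀ l ∈ Set.Ioi (0:ℝ), AnalyticAt ℝ η l from ⟨h, h 1 (Set.mem_Ioi.2 one_pos)⟩
  intro l hl
  rw [funext hη]
  rcases eq_or_ne l 1 with rfl | hl1
  · exact analyticAt_sign_mul_sqrt (analyticAt_two_mul_sub_one_sub_log one_pos)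
      analyticOrderAt_two_mul_sub_one_sub_log
  · have hpos : 2 * (l - 1 - Real.log l) ≠ 0 := by
      have := Real.log_lt_sub_one_of_pos hl hl1
      linarith
    have hsign : AnalyticAt ℝ (fun x => Real.sign (x - 1)) l := by
      rcases lt_or_gt_of_ne hl1 with h | h
      · refine (analyticAt_const (v := -1)).congr ?_
        filter_upwards [gt_mem_nhds h] with x hx
        rw [Real.sign_of_neg (sub_neg.2 hx)]
      · refine (analyticAt_const (v := 1)).congr ?_
        filter_upwards [lt_mem_nhds h] with x hx
        rw [Real.sign_of_pos (sub_pos.2 hx)]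
    exact hsign.mul ((analyticAt_two_mul_sub_one_sub_log hl).real_sqrt hpos)
end

section
/- With η(λ) = sign(λ−1) · √(2(λ − 1 − ln λ)) for λ > 0, the coefficient function C₀(η(λ)) = 1/(λ−1) − 1/η(λ), defined for λ ≠ 1, has a finite limit as λ → 1, namely lim_{λ→1} (1/(λ−1) − 1/η(λ)) = −1/3. -/
open Filter Topology in
/-- The third-order Taylor coefficient of `2 (l - 1 - log l)` at `1`, as a limit. -/
theorem tendsto_log_cubic_remainder :
    Tendsto (fun l : ℝ => (2 * (l - 1 - Real.log l) - (l - 1) ^ 2) / (l - 1) ^ 3)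
      (𝓝[≠] 1) (𝓝 (-(2 / 3))) := by
  rw [tendsto_iff_norm_sub_tendsto_zero]
  have hbound : Tendsto (fun l : ℝ => 2 * |1 - l| / (1 - |1 - l|)) (𝓝[≠] 1) (𝓝 0) := by
    have hcont : ContinuousAt (fun l : ℝ => 2 * |1 - l| / (1 - |1 - l|)) 1 := by
      refine ContinuousAt.div (by fun_prop) (by fun_prop) (by norm_num)
    simpa using hcont.tendsto.mono_left nhdsWithin_le_nhds
  have hnear : ∀ᶠ l : ℝ in 𝓝[≠] 1, |1 - l| < 1 := by
    refine nhdsWithin_le_nhds (ContinuousAt.eventually_lt (by fun_prop) continuousAt_const ?_)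
    norm_num
  refine squeeze_zero' (Eventually.of_forall fun _ => norm_nonneg _) ?_ hbound
  filter_upwards [hnear, self_mem_nhdsWithin] with l hl hne
  have hx : l - 1 ≠ 0 := sub_ne_zero.mpr hne
  have h := Real.abs_log_sub_add_sum_range_le hl 3
  rw [sub_sub_cancel] at h
  have heq : (2 * (l - 1 - Real.log l) - (l - 1) ^ 2) / (l - 1) ^ 3 - -(2 / 3)
      = -2 * (∑ i ∈ Finset.range 3, (1 - l) ^ (i + 1) / ((i : ℝ) + 1) + Real.log l)
        / (l - 1) ^ 3 := by
    simp only [Finset.sum_range_succ, Finset.sum_range_zero]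
    field_simp
    push_cast
    ring
  have hpos : 0 < |1 - l| := abs_pos.mpr (sub_ne_zero.mpr (Ne.symm hne))
  rw [heq, Real.norm_eq_abs, abs_div, abs_mul, abs_pow, abs_sub_comm l 1,
    div_le_iff₀ (by positivity)]
  calc |(-2 : ℝ)| * _ ≤ |(-2 : ℝ)| * (|1 - l| ^ (3 + 1) / (1 - |1 - l|)) := by gcongr
    _ = 2 * |1 - l| / (1 - |1 - l|) * |1 - l| ^ 3 := by
      norm_num
      ring

/-- With `η(λ) = sign(λ-1) √(2(λ - 1 - ln λ))` for `λ > 0`, the coefficient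
`C₀(η(λ)) = 1/(λ-1) - 1/η(λ)` has the finite limit `-1/3` as `λ → 1`. -/
theorem C0_limit (η : ℝ → ℝ)
    (hη : ∀ l : ℝ, η l = Real.sign (l - 1) * Real.sqrt (2 * (l - 1 - Real.log l))) :
    Filter.Tendsto (fun l : ℝ => 1 / (l - 1) - 1 / η l)
      (nhdsWithin 1 (Set.Ioi (0:ℝ) \ {1})) (nhds (-(1/3))) := by
  refine Filter.Tendsto.mono_left ?_ (nhdsWithin_mono (t := {1}ᶜ) 1 fun _ h => h.2)
  set r : ℝ → ℝ := fun l => (2 * (l - 1 - Real.log l) - (l - 1) ^ 2) / (l - 1) ^ 3 with hr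
  have hr_lim : Filter.Tendsto r (nhdsWithin 1 {1}ᶜ) (nhds (-(2 / 3))) :=
    tendsto_log_cubic_remainder
  have hq_lim : Filter.Tendsto (fun l => 1 + (l - 1) * r l) (nhdsWithin 1 {1}ᶜ) (nhds 1) := by
    have hx : Filter.Tendsto (fun l : ℝ => l - 1) (nhdsWithin 1 {1}ᶜ) (nhds (1 - 1)) :=
      ((continuous_id.sub continuous_const).tendsto 1).mono_left nhdsWithin_le_nhds
    simpa using (hx.mul hr_lim).const_add 1
  have hs_lim : Filter.Tendsto (fun l => Real.sqrt (1 + (l - 1) * r l))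
      (nhdsWithin 1 {1}ᶜ) (nhds 1) := by
    simpa using hq_lim.sqrt
  have hlim := hr_lim.div (hs_lim.mul (hs_lim.add_const 1)) (by norm_num)
  rw [show (-(2 / 3) : ℝ) / (1 * (1 + 1)) = -(1 / 3) by norm_num] at hlim
  refine hlim.congr' ?_
  filter_upwards [hq_lim.eventually_const_lt zero_lt_one, self_mem_nhdsWithin] with l hq hne
  have hx : l - 1 ≠ 0 := sub_ne_zero.mpr hne
  have hη_eq : η l = (l - 1) * Real.sqrt (1 + (l - 1) * r l) := by
    have harg : 2 * (l - 1 - Real.log l) = (l - 1) ^ 2 * (1 + (l - 1) * r l) := by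
      simp only [hr]
      field_simp
      ring
    rw [hη, harg, Real.sqrt_mul (sq_nonneg _), Real.sqrt_sq_eq_abs, ← mul_assoc]
    congr 1
    rcases hx.lt_or_gt with h | h
    · rw [Real.sign_of_neg h, abs_of_neg h]; ring
    · rw [Real.sign_of_pos h, abs_of_pos h]; ring
  have hs : 0 < Real.sqrt (1 + (l - 1) * r l) := Real.sqrt_pos.mpr hq
  have hsq := Real.sq_sqrt hq.le
  simp only [Pi.div_apply, hη_eq]
  generalize Real.sqrt (1 + (l - 1) * r l) = s at hs hsq
  have hs' : s + 1 ≠ 0 := by positivity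
  field_simp
  linear_combination -hsq
end

section
/- For every complex number z with Im z < 0, the integral ∫_{−∞}^{∞} e^(−t²)/(t − z) dt converges and equals −π i e^(z²) · erfc(iz), i.e. (1/2)·erfc(iz) = −(e^(z²)/(2πi)) ∫_{−∞}^{∞} e^(−t²)/(t − z) dt, where erfc denotes the entire extension of the complementary error function. -/
open MeasureTheory Complex

/-- The entire extension of the error function:
`erf w = (2/√π) ∫₀^1 w e^(-(s w)²) ds`, integral along the segment from `0` to `w`. -/
noncomputable def cerf (w : ℂ) : ℂ :=
  2 / (Real.sqrt Real.pi : ℂ) * ∫ s in (0:ℝ)..1, w * Complex.exp (-((s : ℂ) * w) ^ 2)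

open Filter Topology in
/-- A primitive of the Gaussian vanishing at `0` tends to `√π / 2` along every right-going
horizontal ray. -/
theorem tendsto_gaussian_primitive {P : ℂ → ℂ} (hP0 : P 0 = 0)
    (hP : ∀ v, HasDerivAt P (Complex.exp (-v ^ 2)) v) (w : ℂ) :
    Tendsto (fun R : ℝ => P (R + w)) atTop (𝓝 ((Real.sqrt Real.pi : ℂ) / 2)) := by
  have hreal : Tendsto (fun R : ℝ => P R) atTop (𝓝 ((Real.sqrt Real.pi : ℂ) / 2)) := by
    have hint : IntegrableOn (fun x : ℝ => Complex.exp (-(1 : ℂ) * (x : ℂ) ^ 2)) (Set.Ioi 0) :=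
      (integrable_cexp_neg_mul_sq (by simp)).integrableOn
    have h := intervalIntegral_tendsto_integral_Ioi (0 : ℝ) hint tendsto_id
    rw [integral_gaussian_complex_Ioi (by simp)] at h
    have hval : ((Real.pi : ℂ) / 1) ^ (1 / 2 : ℂ) = (Real.sqrt Real.pi : ℂ) := by
      rw [div_one, Real.sqrt_eq_rpow, Complex.ofReal_cpow Real.pi_pos.le]
      norm_num
    rw [hval] at h
    refine h.congr fun R => ?_
    rw [intervalIntegral.integral_eq_sub_of_hasDerivAt (f := fun x : ℝ => P x)]
    · simp [hP0]
    · intro x _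
      simpa using (hP x).comp_ofReal
    · exact Continuous.intervalIntegrable (by fun_prop) _ _
  have hdiff : Tendsto (fun R : ℝ => P (R + w) - P R) atTop (𝓝 0) := by
    set M := ‖w‖
    have hlim : Tendsto (fun R : ℝ => Real.exp (M ^ 2 - (R - M) ^ 2) * M) atTop (𝓝 0) := by
      have h1 : Tendsto (fun R : ℝ => (R - M) ^ 2) atTop atTop :=
        (tendsto_pow_atTop two_ne_zero).comp (tendsto_atTop_add_const_right _ (-M) tendsto_id)
      have h2 : Tendsto (fun R : ℝ => M ^ 2 - (R - M) ^ 2) atTop atBot :=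
        tendsto_atBot_add_const_left _ (M ^ 2) (tendsto_neg_atTop_atBot.comp h1)
      simpa using (Real.tendsto_exp_atBot.comp h2).mul_const M
    refine squeeze_zero_norm' ?_ hlim
    filter_upwards [eventually_ge_atTop M] with R hR
    have hw : (R : ℂ) + w ∈ Metric.closedBall (R : ℂ) M := by simp [M]
    have hR' : (R : ℂ) ∈ Metric.closedBall (R : ℂ) M := by simp [M]
    have := (convex_closedBall (R : ℂ) M).norm_image_sub_le_of_norm_hasDerivWithin_le
      (C := Real.exp (M ^ 2 - (R - M) ^ 2))
      (fun x _ => (hP x).hasDerivWithinAt) (fun x hx => ?_) hR' hw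
    · simpa [M] using this
    rw [Complex.norm_exp, Real.exp_le_exp]
    rw [mem_closedBall_iff_norm] at hx
    have hre := (abs_le.1 ((Complex.abs_re_le_norm (x - R)).trans hx)).1
    have him := abs_le.1 ((Complex.abs_im_le_norm (x - R)).trans hx)
    simp only [Complex.sub_re, Complex.sub_im, Complex.ofReal_re, Complex.ofReal_im] at hre him
    simp only [Complex.neg_re, sq, Complex.mul_re]
    nlinarith
  simpa using hdiff.add hreal

theorem integrable_cexp_neg_add_sq (w : ℂ) :
    Integrable (fun s : ℝ => Complex.exp (-((s : ℂ) + w) ^ 2)) := by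
  refine (integrable_cexp_quadratic' (b := -1) (by simp) (-2 * w) (-w ^ 2)).congr ?_
  refine .of_forall fun s => ?_
  simp only
  congr 1
  ring

theorem integral_Ioi_cexp_neg_add_sq (w : ℂ) :
    ∫ s in Set.Ioi (0 : ℝ), Complex.exp (-((s : ℂ) + w) ^ 2) =
      (Real.sqrt Real.pi : ℂ) / 2 * (1 - cerf w) := by
  have hd : Differentiable ℂ fun v : ℂ => Complex.exp (-v ^ 2) := by fun_prop
  obtain ⟨P, hP0, hP⟩ := hd.isExactOn_univ.with_val_at 0 0
  replace hP := fun v => hP v (Set.mem_univ v)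
  have herf : cerf w = 2 / (Real.sqrt Real.pi : ℂ) * P w := by
    rw [cerf, intervalIntegral.integral_eq_sub_of_hasDerivAt (f := fun s : ℝ => P (s * w))]
    · simp [hP0]
    · intro s _
      have h1 : HasDerivAt (fun s : ℂ => s * w) w (s : ℂ) := by
        simpa using (hasDerivAt_id (s : ℂ)).mul_const w
      have := ((hP (s * w)).comp (s : ℂ) h1).comp_ofReal
      simpa [mul_comm, Function.comp_def] using this
    · exact Continuous.intervalIntegrable (by fun_prop) _ _
  rw [integral_Ioi_of_hasDerivAt_of_tendsto' (f := fun s : ℝ => P (s + w)) (fun s _ => ?_)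
    (integrable_cexp_neg_add_sq w).integrableOn (tendsto_gaussian_primitive hP0 hP w), herf]
  · have : (Real.sqrt Real.pi : ℂ) ≠ 0 := by
      exact_mod_cast (Real.sqrt_pos.2 Real.pi_pos).ne'
    simp only [Complex.ofReal_zero, zero_add]
    field_simp
  · exact ((hP (s + w)).comp_add_const (s : ℂ) w).comp_ofReal

theorem integrable_cexp_neg_sq_div_sub {z : ℂ} (hz : z.im < 0) :
    Integrable (fun t : ℝ => Complex.exp (-(t : ℂ) ^ 2) / ((t : ℂ) - z)) := by
  have hne (t : ℝ) : (t : ℂ) - z ≠ 0 := fun h => by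
    have := congrArg Complex.im h
    simp only [Complex.sub_im, Complex.ofReal_im, Complex.zero_im] at this
    linarith
  have hg : Integrable (fun t : ℝ => Complex.exp (-(t : ℂ) ^ 2)) := by
    simpa using integrable_cexp_neg_add_sq 0
  simp_rw [div_eq_mul_inv]
  refine hg.mul_bdd (c := (-z.im)⁻¹) ?_ (.of_forall fun t => ?_)
  · exact (Continuous.inv₀ (by fun_prop) hne).aestronglyMeasurable
  · rw [norm_inv]
    refine inv_anti₀ (by linarith) ?_
    simpa using (le_abs_self _).trans (Complex.abs_im_le_norm ((t : ℂ) - z))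

theorem inv_sub_eq_integral_Ioi {z : ℂ} (hz : z.im < 0) (t : ℝ) :
    ((t : ℂ) - z)⁻¹ =
      -2 * Complex.I * ∫ s in Set.Ioi (0 : ℝ), Complex.exp (2 * Complex.I * (t - z) * s) := by
  have hne : (t : ℂ) - z ≠ 0 := fun h => by
    have := congrArg Complex.im h
    simp only [Complex.sub_im, Complex.ofReal_im, Complex.zero_im] at this
    linarith
  rw [integral_exp_mul_complex_Ioi (by simp; linarith)]
  field_simp
  simp

theorem integrable_prod_gaussian_laplace {z : ℂ} (hz : z.im < 0) :
    Integrable (Function.uncurry fun t s : ℝ =>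
      Complex.exp (-(t : ℂ) ^ 2) * Complex.exp (2 * Complex.I * (t - z) * s))
      (volume.prod (volume.restrict (Set.Ioi 0))) := by
  have hg : Integrable (fun t : ℝ => Complex.exp (-(t : ℂ) ^ 2)) := by
    simpa using integrable_cexp_neg_add_sq 0
  have he : IntegrableOn (fun s : ℝ => Complex.exp (-2 * Complex.I * z * s)) (Set.Ioi 0) :=
    integrableOn_exp_mul_complex_Ioi (by simp; linarith) 0
  refine (hg.mul_prod he).mono (Continuous.aestronglyMeasurable (by fun_prop))
    (.of_forall fun p => le_of_eq ?_)
  simp [Function.uncurry, Complex.norm_exp]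

theorem integral_gaussian_mul_cexp (z : ℂ) (s : ℝ) :
    ∫ t : ℝ, Complex.exp (-(t : ℂ) ^ 2) * Complex.exp (2 * Complex.I * (t - z) * s) =
      (Real.sqrt Real.pi : ℂ) * Complex.exp (-z ^ 2) *
        Complex.exp (-((s : ℂ) + Complex.I * z) ^ 2) := by
  have h := integral_cexp_quadratic (b := -1) (by simp) (2 * Complex.I * s) (-2 * Complex.I * z * s)
  have hval : ((Real.pi : ℂ) / - -1) ^ (1 / 2 : ℂ) = (Real.sqrt Real.pi : ℂ) := by
    rw [neg_neg, div_one, Real.sqrt_eq_rpow, Complex.ofReal_cpow Real.pi_pos.le]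
    norm_num
  rw [hval] at h
  rw [mul_assoc, ← Complex.exp_add]
  convert h using 2
  · ext t
    rw [← Complex.exp_add]
    congr 1
    ring
  · congr 1
    linear_combination (-z ^ 2 - s ^ 2) * Complex.I_sq

/-- For every complex `z` with `Im z < 0`, the integral `∫_{-∞}^{∞} e^(-t²)/(t-z) dt`
converges and `(1/2) erfc(iz) = -(e^(z²)/(2πi)) ∫_{-∞}^{∞} e^(-t²)/(t-z) dt`. -/
theorem half_erfc_integral (z : ℂ) (hz : z.im < 0) :
    Integrable (fun t : ℝ => Complex.exp (-(t : ℂ) ^ 2) / ((t : ℂ) - z)) ∧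
    (1 - cerf (Complex.I * z)) / 2 =
      -(Complex.exp (z ^ 2) / (2 * (Real.pi : ℂ) * Complex.I)) *
        ∫ t : ℝ, Complex.exp (-(t : ℂ) ^ 2) / ((t : ℂ) - z) := by
  refine ⟨integrable_cexp_neg_sq_div_sub hz, ?_⟩
  have hint : ∫ t : ℝ, Complex.exp (-(t : ℂ) ^ 2) / ((t : ℂ) - z) =
      -2 * Complex.I * ((Real.sqrt Real.pi : ℂ) * Complex.exp (-z ^ 2) *
        ((Real.sqrt Real.pi : ℂ) / 2 * (1 - cerf (Complex.I * z)))) := by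
    rw [← integral_Ioi_cexp_neg_add_sq, ← integral_const_mul]
    simp_rw [← integral_gaussian_mul_cexp]
    rw [← integral_integral_swap (integrable_prod_gaussian_laplace hz), ← integral_const_mul]
    congr 1 with t
    rw [div_eq_mul_inv, inv_sub_eq_integral_Ioi hz, integral_const_mul]
    ring
  have hexp : Complex.exp (z ^ 2) * Complex.exp (-z ^ 2) = 1 := by
    rw [← Complex.exp_add, add_neg_cancel, Complex.exp_zero]
  have hsqrt : (Real.sqrt Real.pi : ℂ) * (Real.sqrt Real.pi : ℂ) = Real.pi := by
    rw [← Complex.ofReal_mul, Real.mul_self_sqrt Real.pi_pos.le]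
  have hpi : (Real.pi : ℂ) ≠ 0 := Complex.ofReal_ne_zero.2 Real.pi_ne_zero
  calc (1 - cerf (Complex.I * z)) / 2
      = (Complex.exp (z ^ 2) * Complex.exp (-z ^ 2)) *
          ((Real.sqrt Real.pi : ℂ) * (Real.sqrt Real.pi : ℂ)) / Real.pi *
          (1 - cerf (Complex.I * z)) / 2 := by
        rw [hexp, hsqrt, one_mul, div_self hpi, one_mul]
    _ = _ := by
        rw [hint]
        field_simp [Complex.I_ne_zero]
end

section
/- For every complex number a with a ∉ {−1, −2, −3, …} and every complex number z, the function γ*(a,z) := e^(−z) · ∑_{n=0}^∞ z^n / Γ(a+n+1) satisfies the recursion γ*(−a−1, −z) + z · γ*(−a, −z) = −(1/π) · sin(πa) · e^z · Γ(a+1). -/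
/-- The entire function `γ*(a,z) = e^(-z) ∑_{n=0}^∞ z^n / Γ(a+n+1)`. -/
noncomputable def gammaStar (a z : ℂ) : ℂ :=
  Complex.exp (-z) * ∑' n : ℕ, z ^ n / Complex.Gamma (a + n + 1)

theorem summable_pow_div_Gamma_add (b w : ℂ) :
    Summable fun n : ℕ => w ^ n / Complex.Gamma (b + n) := by
  refine summable_of_ratio_norm_eventually_le (r := 1 / 2) (by norm_num) ?_
  obtain ⟨N, hN⟩ := exists_nat_gt (‖b‖ + 2 * ‖w‖ + 1)
  filter_upwards [Filter.eventually_ge_atTop N] with n hn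
  have hn' : (N : ℝ) ≤ n := by exact_mod_cast hn
  have hb : 2 * ‖w‖ + 1 ≤ ‖b + n‖ := by
    have h := norm_sub_norm_le (n : ℂ) (-b)
    rw [norm_neg, sub_neg_eq_add, add_comm (n : ℂ) b, Complex.norm_natCast] at h
    linarith
  have hw := norm_nonneg w
  have hs : b + n ≠ 0 := norm_pos_iff.mp (by linarith)
  have hratio : w ^ (n + 1) / Complex.Gamma (b + (n + 1 : ℕ)) =
      w / (b + n) * (w ^ n / Complex.Gamma (b + n)) := by
    rw [Nat.cast_add_one, ← add_assoc, Complex.Gamma_add_one _ hs, pow_succ', mul_div_mul_comm]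
  rw [hratio, norm_mul, norm_div]
  refine mul_le_mul_of_nonneg_right ?_ (norm_nonneg _)
  rw [div_le_iff₀ (by linarith)]
  linarith

theorem inv_Gamma_neg_eq (a : ℂ) (ha : ∀ n : ℕ, a ≠ -((n : ℂ) + 1)) :
    (Complex.Gamma (-a))⁻¹ =
      -(1 / (Real.pi : ℂ)) * Complex.sin ((Real.pi : ℂ) * a) * Complex.Gamma (a + 1) := by
  have hΓ : Complex.Gamma (a + 1) ≠ 0 :=
    Complex.Gamma_ne_zero fun m h => ha m (by linear_combination h)
  have h := congrArg Inv.inv (Complex.Gamma_mul_Gamma_one_sub (-a))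
  rw [sub_neg_eq_add, add_comm 1 a, mul_inv, inv_div, mul_neg, Complex.sin_neg] at h
  rw [← mul_inv_cancel_right₀ hΓ (Complex.Gamma (-a))⁻¹, mul_right_comm, h]
  ring

/-- For every complex `a ∉ {-1,-2,-3,…}` and every complex `z`,
`γ*(-a-1,-z) + z γ*(-a,-z) = -(1/π) sin(πa) e^z Γ(a+1)`. -/
theorem gammaStar_recursion (a : ℂ) (ha : ∀ n : ℕ, a ≠ -((n : ℂ) + 1)) (z : ℂ) :
    gammaStar (-a - 1) (-z) + z * gammaStar (-a) (-z) =
      -(1 / (Real.pi : ℂ)) * Complex.sin ((Real.pi : ℂ) * a) * Complex.exp z *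
        Complex.Gamma (a + 1) := by
  have hfst : ∑' n : ℕ, (-z) ^ n / Complex.Gamma (-a - 1 + n + 1) =
      (Complex.Gamma (-a))⁻¹ + -z * ∑' n : ℕ, (-z) ^ n / Complex.Gamma (-a + n + 1) := by
    have hshift (n : ℕ) : -a - 1 + (n : ℂ) + 1 = -a + n := by ring
    simp_rw [hshift]
    rw [(summable_pow_div_Gamma_add (-a) (-z)).tsum_eq_zero_add, ← tsum_mul_left]
    simp [pow_succ', neg_div, mul_div_assoc, add_assoc]
  rw [gammaStar, gammaStar, hfst, inv_Gamma_neg_eq a ha, neg_neg]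
  ring
end

section
/- Let a > 0 and z > 0 be real, set λ = z/a. Let ζ : (0,∞) → ℝ, ζ(t) = sign(t−1)·√(2(t − ln t − 1)), which is a strictly increasing bijection, and let t(·) : ℝ → (0,∞) denote its inverse; set η = ζ(λ). Define g : ℝ → ℝ by g(ζ) = ζ · t(ζ) · (ζ − η) / ((t(ζ) − 1)(t(ζ) − λ)) for ζ ∉ {0, η}, extended continuously to ζ = 0 and ζ = η (in particular g(η) = 1), and define h : ℝ → ℝ by h(ζ) = (g(ζ) − 1)/(ζ − η) for ζ ≠ η, extended continuously at ζ = η. Then the integral T_a(η) = −√(a/(2π)) ∫_{−∞}^{∞} e^(−aζ²/2) h(ζ) dζ converges absolutely, and γ*(−a, −z) = z^a · { cos(πa) − √(2a/π) · e^(aη²/2) · sin(πa) · [ √(2/a) · F(η·√(a/2)) + (1/a)·T_a(η) ] }, where F is Dawson's integral and γ*(a,z) := e^(−z) · ∑_{n=0}^∞ z^n / Γ(a+n+1). -/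
open MeasureTheory

/-- Dawson's integral `F(x) = e^(-x²) ∫₀^x e^(t²) dt`. -/
noncomputable def dawson (x : ℝ) : ℝ :=
  Real.exp (-x ^ 2) * ∫ t in (0:ℝ)..x, Real.exp (t ^ 2)

lemma integrableOn_Ioo_rpow {r : ℝ} (hr : -1 < r) :
    IntegrableOn (fun v : ℝ => v ^ r) (Set.Ioo 0 1) := by
  have h := (intervalIntegral.intervalIntegrable_rpow' (a := 0) (b := 1) hr)
  rw [intervalIntegrable_iff_integrableOn_Ioo_of_le zero_le_one] at h
  exact h

lemma integral_Ioo_rpow {r : ℝ} (hr : -1 < r) :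
    ∫ v in Set.Ioo (0 : ℝ) 1, v ^ r = 1 / (r + 1) := by
  rw [← integral_Ioc_eq_integral_Ioo, ← intervalIntegral.integral_of_le zero_le_one,
    integral_rpow (Or.inl hr), Real.one_rpow, Real.zero_rpow (by linarith), sub_zero]

lemma summable_one_div_sub_one_div {s : ℝ} (hs : -1 < s) (hs0 : s ≤ 0) :
    Summable (fun n : ℕ => |1 / ((n : ℝ) + 1 / 2) - 1 / (n + 1 + s)|) := by
  have h1 : Summable (fun n : ℕ => (2 * |s + 1 / 2| / (s + 1)) * (1 / ((n + 1 : ℕ) : ℝ) ^ 2)) :=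
    ((summable_nat_add_iff 1).2 (Real.summable_one_div_nat_pow.2 one_lt_two)).mul_left _
  refine Summable.of_nonneg_of_le (fun n => abs_nonneg _) (fun n => ?_) h1
  have hn : (0 : ℝ) ≤ n := n.cast_nonneg
  have e : 1 / ((n : ℝ) + 1 / 2) - 1 / (n + 1 + s)
      = (s + 1 / 2) / ((n + 1 / 2) * (n + 1 + s)) := by
    have : (n : ℝ) + 1 + s ≠ 0 := by linarith
    field_simp
    ring
  have hp : 0 < ((n : ℝ) + 1 / 2) * (n + 1 + s) := by
    apply mul_pos <;> linarith
  have hp' : 0 < s + 1 := by linarith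
  rw [e, abs_div, abs_of_pos hp]
  have e2 : (2 * |s + 1 / 2| / (s + 1)) * (1 / ((n + 1 : ℕ) : ℝ) ^ 2)
      = |s + 1 / 2| / (((n + 1) / 2) * ((s + 1) * (n + 1))) := by
    push_cast
    field_simp
  rw [e2]
  gcongr
  · linarith
  · nlinarith

lemma hasSum_integral_Ioo_rpow_sub_div {s : ℝ} (hs : -1 < s) (hs0 : s ≤ 0) :
    IntegrableOn (fun v : ℝ => (v ^ s - v ^ (-(1 / 2) : ℝ)) / (v - 1)) (Set.Ioo 0 1) ∧
    HasSum (fun n : ℕ => 1 / ((n : ℝ) + 1 / 2) - 1 / (n + 1 + s))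
      (∫ v in Set.Ioo (0 : ℝ) 1, (v ^ s - v ^ (-(1 / 2) : ℝ)) / (v - 1)) := by
  set F : ℕ → ℝ → ℝ := fun n v => v ^ ((n : ℝ) - 1 / 2) - v ^ ((n : ℝ) + s) with hF
  have hn (n : ℕ) : (0 : ℝ) ≤ n := n.cast_nonneg
  have hFint (n : ℕ) : IntegrableOn (F n) (Set.Ioo 0 1) :=
    (integrableOn_Ioo_rpow (by linarith [hn n])).sub (integrableOn_Ioo_rpow (by linarith [hn n]))
  have hFval (n : ℕ) : ∫ v in Set.Ioo (0 : ℝ) 1, F n v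
      = 1 / ((n : ℝ) + 1 / 2) - 1 / (n + 1 + s) := by
    rw [hF, integral_sub (integrableOn_Ioo_rpow (by linarith [hn n]))
      (integrableOn_Ioo_rpow (by linarith [hn n])), integral_Ioo_rpow (by linarith [hn n]),
      integral_Ioo_rpow (by linarith [hn n])]
    congr 2 <;> ring
  have hFeq (n : ℕ) (v : ℝ) (hv : v ∈ Set.Ioo (0 : ℝ) 1) :
      F n v = v ^ n * (v ^ (-(1 / 2) : ℝ) - v ^ s) := by
    simp only [hF]
    rw [show (n : ℝ) - 1 / 2 = n + (-(1 / 2)) by ring, Real.rpow_add hv.1, Real.rpow_add hv.1,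
      Real.rpow_natCast]
    ring
  have hsum (v : ℝ) (hv : v ∈ Set.Ioo (0 : ℝ) 1) :
      ∑' n, F n v = (v ^ s - v ^ (-(1 / 2) : ℝ)) / (v - 1) := by
    rw [tsum_congr (fun n => hFeq n v hv), tsum_mul_right, tsum_geometric_of_lt_one hv.1.le hv.2]
    have : 1 - v ≠ 0 := by linarith [hv.2]
    have : v - 1 ≠ 0 := by linarith [hv.2]
    field_simp
    ring
  obtain ⟨σ, hσ, hσF⟩ : ∃ σ : ℝ, |σ| = 1 ∧ ∀ v ∈ Set.Ioo (0 : ℝ) 1,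
      0 ≤ σ * (v ^ (-(1 / 2) : ℝ) - v ^ s) := by
    rcases le_total (-(1 / 2)) s with h | h
    · refine ⟨1, by simp, fun v hv => ?_⟩
      have := Real.rpow_le_rpow_of_exponent_ge hv.1 hv.2.le h
      linarith
    · refine ⟨-1, by simp, fun v hv => ?_⟩
      have := Real.rpow_le_rpow_of_exponent_ge hv.1 hv.2.le h
      linarith
  have hnorm (n : ℕ) : ∫ v in Set.Ioo (0 : ℝ) 1, ‖F n v‖
      = |1 / ((n : ℝ) + 1 / 2) - 1 / (n + 1 + s)| := by
    have h1 : ∫ v in Set.Ioo (0 : ℝ) 1, ‖F n v‖ = ∫ v in Set.Ioo (0 : ℝ) 1, σ * F n v := by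
      refine setIntegral_congr_fun measurableSet_Ioo fun v hv => ?_
      have : 0 ≤ σ * F n v := by
        rw [hFeq n v hv, mul_left_comm]
        exact mul_nonneg (pow_nonneg hv.1.le n) (hσF v hv)
      rw [← abs_of_nonneg this, abs_mul, hσ, one_mul, Real.norm_eq_abs]
    have h2 : 0 ≤ ∫ v in Set.Ioo (0 : ℝ) 1, ‖F n v‖ := integral_nonneg fun _ => norm_nonneg _
    rw [← abs_of_nonneg h2, h1, integral_const_mul, hFval, abs_mul, hσ, one_mul]
  have key := hasSum_integral_of_summable_integral_norm (μ := volume.restrict (Set.Ioo (0:ℝ) 1))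
    (F := F) hFint (by simpa only [hnorm] using summable_one_div_sub_one_div hs hs0)
  rw [setIntegral_congr_fun measurableSet_Ioo hsum] at key
  simp only [hFval] at key
  refine ⟨?_, key⟩
  by_cases hs2 : s = -(1 / 2)
  · simp [hs2]
  · by_contra hni
    rw [integral_undef hni] at key
    have hterm (n : ℕ) : 1 / ((n : ℝ) + 1 / 2) - 1 / (n + 1 + s)
        = (s + 1 / 2) * (1 / ((n + 1 / 2) * (n + 1 + s))) := by
      have : (n : ℝ) + 1 + s ≠ 0 := by linarith [hn n]
      have : (n : ℝ) + 1 / 2 ≠ 0 := by linarith [hn n]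
      field_simp
      ring
    simp only [hterm] at key
    have hne : s + 1 / 2 ≠ 0 := fun h => hs2 (by linarith)
    have key2 := (hasSum_mul_left_iff hne).1 ((mul_zero (s + 1 / 2)).symm ▸ key)
    have hpos (n : ℕ) : 0 < 1 / (((n : ℝ) + 1 / 2) * (n + 1 + s)) :=
      one_div_pos.2 (mul_pos (by linarith [hn n]) (by linarith [hn n]))
    have := (hasSum_zero_iff_of_nonneg fun n => (hpos n).le).1 key2
    exact (hpos 0).ne' (congrFun this 0)

lemma image_inv_Ioo_zero_one : (fun v : ℝ => v⁻¹) '' Set.Ioo 0 1 = Set.Ioi 1 := by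
  ext x
  constructor
  · rintro ⟨v, hv, rfl⟩
    exact (one_lt_inv₀ hv.1).2 hv.2
  · intro hx
    have hx' : (1 : ℝ) < x := hx
    exact ⟨x⁻¹, ⟨by positivity, inv_lt_one_of_one_lt₀ hx'⟩, inv_inv x⟩

lemma rpow_sub_div_comp_inv (b : ℝ) {v : ℝ} (hv : v ∈ Set.Ioo (0 : ℝ) 1) :
    |-(v ^ 2)⁻¹| • (((v⁻¹) ^ b - (v⁻¹) ^ (-(1 / 2) : ℝ)) / (v⁻¹ - 1))
      = -((v ^ (-b - 1) - v ^ (-(1 / 2) : ℝ)) / (v - 1)) := by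
  have h0 := hv.1
  have h1 : v - 1 ≠ 0 := by linarith [hv.2]
  have h2 : 1 - v ≠ 0 := by linarith [hv.2]
  have h3 : v⁻¹ - 1 ≠ 0 := by
    have := (one_lt_inv₀ hv.1).2 hv.2
    linarith
  have e1 : (v⁻¹) ^ b = v ^ (-b - 1) * v := by
    rw [Real.inv_rpow h0.le, ← Real.rpow_neg h0.le]
    nth_rw 3 [← Real.rpow_one v]
    rw [← Real.rpow_add h0]
    congr 1
    ring
  have e2 : (v⁻¹) ^ (-(1 / 2) : ℝ) = v ^ (-(1 / 2) : ℝ) * v := by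
    rw [Real.inv_rpow h0.le, ← Real.rpow_neg h0.le]
    nth_rw 3 [← Real.rpow_one v]
    rw [← Real.rpow_add h0]
    congr 1
    ring
  have e3 : v⁻¹ - 1 = (1 - v) / v := by field_simp
  rw [e1, e2, e3, abs_neg, abs_of_pos (by positivity), smul_eq_mul]
  field_simp
  ring

lemma integrableOn_Ioi_rpow_sub_div {b : ℝ} (hb : -1 < b) (hb0 : b < 0) :
    IntegrableOn (fun v : ℝ => (v ^ b - v ^ (-(1 / 2) : ℝ)) / (v - 1)) (Set.Ioi 0) ∧
    HasSum (fun n : ℕ => 1 / ((n : ℝ) - b) - 1 / (n + 1 + b))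
      (∫ v in Set.Ioi (0 : ℝ), (v ^ b - v ^ (-(1 / 2) : ℝ)) / (v - 1)) := by
  obtain ⟨i1, s1⟩ := hasSum_integral_Ioo_rpow_sub_div hb hb0.le
  obtain ⟨i2, s2⟩ := hasSum_integral_Ioo_rpow_sub_div (s := -b - 1) (by linarith) (by linarith)
  have hd : ∀ x ∈ Set.Ioo (0 : ℝ) 1,
      HasDerivWithinAt (fun v : ℝ => v⁻¹) (-(x ^ 2)⁻¹) (Set.Ioo 0 1) x :=
    fun x hx => (hasDerivAt_inv hx.1.ne').hasDerivWithinAt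
  have hinj : Set.InjOn (fun v : ℝ => v⁻¹) (Set.Ioo 0 1) := inv_injective.injOn
  have i3 : IntegrableOn (fun v : ℝ => (v ^ b - v ^ (-(1 / 2) : ℝ)) / (v - 1)) (Set.Ioi 1) := by
    rw [← image_inv_Ioo_zero_one,
      integrableOn_image_iff_integrableOn_abs_deriv_smul measurableSet_Ioo hd hinj]
    exact (integrableOn_congr_fun (fun v hv => rpow_sub_div_comp_inv b hv) measurableSet_Ioo).2
      i2.neg
  have s3 : ∫ v in Set.Ioi (1 : ℝ), (v ^ b - v ^ (-(1 / 2) : ℝ)) / (v - 1)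
      = - ∫ v in Set.Ioo (0 : ℝ) 1, (v ^ (-b - 1) - v ^ (-(1 / 2) : ℝ)) / (v - 1) := by
    rw [← image_inv_Ioo_zero_one,
      integral_image_eq_integral_abs_deriv_smul measurableSet_Ioo hd hinj, ← integral_neg]
    exact setIntegral_congr_fun measurableSet_Ioo fun v hv => rpow_sub_div_comp_inv b hv
  have i1' := (integrableOn_Ioc_iff_integrableOn_Ioo (by simp)).2 i1
  have hU : Set.Ioi (0 : ℝ) = Set.Ioc 0 1 ∪ Set.Ioi 1 := by
    rw [Set.Ioc_union_Ioi_eq_Ioi zero_le_one]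
  refine ⟨by rw [hU]; exact i1'.union i3, ?_⟩
  rw [hU, setIntegral_union (Set.Ioc_disjoint_Ioi le_rfl) measurableSet_Ioi i1' i3, s3,
    integral_Ioc_eq_integral_Ioo]
  rw [← sub_eq_add_neg]
  have e (n : ℕ) : 1 / ((n : ℝ) - b) - 1 / (n + 1 + b) = 1 / ((n : ℝ) + 1 / 2) - 1 / (n + 1 + b)
      - (1 / ((n : ℝ) + 1 / 2) - 1 / (n + 1 + (-b - 1))) := by
    rw [show (n : ℝ) + 1 + (-b - 1) = n - b by ring]
    ring
  simp only [e]
  exact s1.sub s2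

lemma sin_mul_integral_rpow_sub_div {b : ℝ} (hb : -1 < b) (hb0 : b < 0) :
    Real.sin (Real.pi * b) *
      (∫ v in Set.Ioi (0 : ℝ), (v ^ b - v ^ (-(1 / 2) : ℝ)) / (v - 1))
      = -(Real.pi * Real.cos (Real.pi * b)) := by
  have hsum := (integrableOn_Ioi_rpow_sub_div hb hb0).2
  set K := ∫ v in Set.Ioi (0 : ℝ), (v ^ b - v ^ (-(1 / 2) : ℝ)) / (v - 1) with hK
  have hbZ : (b : ℂ) ∈ Complex.integerComplement := by
    rintro ⟨m, hm⟩
    have hm' : (m : ℝ) = b := by exact_mod_cast hm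
    have h1 : (-1 : ℝ) < m := by rw [hm']; exact hb
    have h2 : (m : ℝ) < 0 := by rw [hm']; exact hb0
    have h1' : -1 < m := by exact_mod_cast h1
    have h2' : m < 0 := by exact_mod_cast h2
    omega
  have t1 : Filter.Tendsto (fun N : ℕ => ((∑ n ∈ Finset.range (N + 1),
      (1 / ((n : ℝ) - b) - 1 / (n + 1 + b)) : ℝ) : ℂ)) Filter.atTop (nhds (K : ℂ)) :=
    (Complex.continuous_ofReal.tendsto K).comp
      (hsum.tendsto_sum_nat.comp (Filter.tendsto_add_atTop_nat 1))
  have t2 := tendsto_logDeriv_euler_cot_sub hbZ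
  have t3 : Filter.Tendsto (fun N : ℕ => ((1 / ((N : ℝ) + (1 + b)) : ℝ) : ℂ)) Filter.atTop
      (nhds ((0 : ℝ) : ℂ)) := by
    refine (Complex.continuous_ofReal.tendsto 0).comp ?_
    simp only [one_div]
    exact (Filter.tendsto_atTop_add_const_right _ _ tendsto_natCast_atTop_atTop).inv_tendsto_atTop
  have hpart (N : ℕ) : ((∑ n ∈ Finset.range (N + 1),
      (1 / ((n : ℝ) - b) - 1 / (n + 1 + b)) : ℝ) : ℂ)
      = -(1 / (b : ℂ)) - ∑ n ∈ Finset.range N, cotTerm b n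
        - ((1 / ((N : ℝ) + (1 + b)) : ℝ) : ℂ) := by
    have hreal : ∑ n ∈ Finset.range (N + 1), (1 / ((n : ℝ) - b) - 1 / (n + 1 + b))
        = -(1 / b) - ∑ n ∈ Finset.range N, (1 / (b - (n + 1)) + 1 / (b + (n + 1)))
          - 1 / ((N : ℝ) + (1 + b)) := by
      induction N with
      | zero => simp [div_eq_mul_inv, inv_neg]
      | succ N ih =>
        rw [Finset.sum_range_succ, ih, Finset.sum_range_succ _ N]
        have e : 1 / (b - ((N : ℝ) + 1)) = -(1 / (((N + 1 : ℕ) : ℝ) - b)) := by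
          rw [← one_div_neg_eq_neg_one_div]
          push_cast
          congr 1
          ring
        have e2 : (N : ℝ) + (1 + b) = b + (N + 1) := by ring
        have e3 : (((N + 1 : ℕ) : ℝ) + 1 + b) = ((N + 1 : ℕ) : ℝ) + (1 + b) := by ring
        rw [e, e2, e3]
        ring
    rw [hreal]
    push_cast
    rfl
  simp only [hpart] at t1
  have t4 := tendsto_nhds_unique t1 ((t2.const_sub (-(1 / (b : ℂ)))).sub t3)
  have hsin := sin_pi_mul_ne_zero hbZ
  have t5 : (K : ℂ) = -(Real.pi * Complex.cos (Real.pi * b) / Complex.sin (Real.pi * b)) := by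
    rw [t4, Complex.cot]
    push_cast
    ring
  have t6 : Complex.sin (Real.pi * b) * (K : ℂ) = -(Real.pi * Complex.cos (Real.pi * b)) := by
    rw [t5]
    field_simp
  exact_mod_cast t6

lemma factorial_mul_Gamma_le {c : ℝ} (hc : 0 < c) (n : ℕ) :
    (n.factorial : ℝ) * Real.Gamma (c + 1) ≤ Real.Gamma (c + n + 1) := by
  induction n with
  | zero => simp
  | succ n ih =>
    have hG : 0 < Real.Gamma (c + 1) := Real.Gamma_pos_of_pos (by linarith)
    have hn : (0 : ℝ) ≤ n := n.cast_nonneg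
    rw [show c + ((n + 1 : ℕ) : ℝ) + 1 = (c + n + 1) + 1 by push_cast; ring,
      Real.Gamma_add_one (show c + n + 1 ≠ 0 by positivity), Nat.factorial_succ]
    push_cast
    rw [mul_assoc]
    exact mul_le_mul (by linarith) ih (by positivity) (by positivity)

lemma summable_pow_div_Gamma {c : ℝ} (hc : 0 < c) (x : ℝ) :
    Summable (fun n : ℕ => x ^ n / Real.Gamma (c + n + 1)) := by
  have hG : 0 < Real.Gamma (c + 1) := Real.Gamma_pos_of_pos (by linarith)
  have h1 := (Real.summable_pow_div_factorial |x|).mul_right (Real.Gamma (c + 1))⁻¹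
  refine Summable.of_norm_bounded h1 fun n => ?_
  have hf : (0 : ℝ) < n.factorial := by exact_mod_cast n.factorial_pos
  have hG2 : 0 < Real.Gamma (c + n + 1) := Real.Gamma_pos_of_pos (by positivity)
  rw [Real.norm_eq_abs, abs_div, abs_pow, abs_of_pos hG2, ← div_eq_mul_inv, div_div]
  gcongr
  exact factorial_mul_Gamma_le hc n

lemma intervalIntegrable_rpow_mul_exp {c : ℝ} (hc : 0 < c) (z : ℝ) :
    IntervalIntegrable (fun y : ℝ => y ^ (c - 1) * Real.exp y) volume 0 z :=
  (intervalIntegral.intervalIntegrable_rpow' (by linarith)).mul_continuousOn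
    Real.continuous_exp.continuousOn

lemma integral_rpow_mul_exp_recurrence {c z : ℝ} (hc : 0 < c) (hz : 0 < z) :
    c * ∫ y in (0 : ℝ)..z, y ^ (c - 1) * Real.exp y
      = z ^ c * Real.exp z - ∫ y in (0 : ℝ)..z, y ^ c * Real.exp y := by
  have hd : ∀ y ∈ Set.Ioo (0 : ℝ) z \ ∅, HasDerivAt (fun y : ℝ => y ^ c * Real.exp y)
      (c * (y ^ (c - 1) * Real.exp y) + y ^ c * Real.exp y) y := by
    intro y hy
    have := (Real.hasDerivAt_rpow_const (p := c) (Or.inl hy.1.1.ne')).mul (Real.hasDerivAt_exp y)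
    exact this.congr_deriv (by ring)
  have i1 := intervalIntegrable_rpow_mul_exp hc z
  have i2 : IntervalIntegrable (fun y : ℝ => y ^ c * Real.exp y) volume 0 z := by
    simpa using intervalIntegrable_rpow_mul_exp (c := c + 1) (by linarith) z
  have hcont : ContinuousOn (fun y : ℝ => y ^ c * Real.exp y) (Set.Icc 0 z) :=
    ((Real.continuous_rpow_const hc.le).mul Real.continuous_exp).continuousOn
  have h := integral_eq_of_hasDerivAt_off_countable_of_le _ _ hz.le Set.countable_empty hcont hd
    ((i1.const_mul c).add i2)
  rw [intervalIntegral.integral_add (i1.const_mul c) i2,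
    intervalIntegral.integral_const_mul, Real.zero_rpow hc.ne'] at h
  linarith

lemma integral_rpow_mul_exp_bounds {c z : ℝ} (hc : 0 < c) (hz : 0 < z) :
    0 ≤ ∫ y in (0 : ℝ)..z, y ^ (c - 1) * Real.exp y ∧
    c * ∫ y in (0 : ℝ)..z, y ^ (c - 1) * Real.exp y ≤ z ^ c * Real.exp z := by
  have hnn (p : ℝ) : 0 ≤ ∫ y in (0 : ℝ)..z, y ^ p * Real.exp y :=
    intervalIntegral.integral_nonneg hz.le fun y hy =>
      mul_nonneg (Real.rpow_nonneg hy.1 _) (Real.exp_pos _).le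
  refine ⟨hnn _, ?_⟩
  rw [integral_rpow_mul_exp_recurrence hc hz]
  linarith [hnn c]

lemma sum_range_pow_div_Gamma {c z : ℝ} (hc : 0 < c) (hz : 0 < z) (N : ℕ) :
    (∫ y in (0 : ℝ)..z, y ^ (c - 1) * Real.exp y) / Real.Gamma c
      = z ^ c * Real.exp z * ∑ n ∈ Finset.range N, (-z) ^ n / Real.Gamma (c + n + 1)
        + (-1) ^ N * ((∫ y in (0 : ℝ)..z, y ^ (c + N - 1) * Real.exp y) / Real.Gamma (c + N)) := by
  induction N with
  | zero => simp
  | succ N ih =>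
    have hcN : 0 < c + N := by positivity
    have hG : 0 < Real.Gamma (c + N) := Real.Gamma_pos_of_pos hcN
    have hr := integral_rpow_mul_exp_recurrence hcN hz
    rw [ih, Finset.sum_range_succ, mul_add, add_assoc]
    congr 1
    rw [show c + ((N + 1 : ℕ) : ℝ) - 1 = c + N by push_cast; ring,
      show c + ((N + 1 : ℕ) : ℝ) = c + N + 1 by push_cast; ring, Real.Gamma_add_one hcN.ne',
       eq_sub_of_add_eq' (eq_sub_iff_add_eq.1 hr), Real.rpow_add hz, Real.rpow_natCast,
      neg_pow z N]
    field_simp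
    ring

lemma tsum_pow_div_Gamma {c z : ℝ} (hc : 0 < c) (hz : 0 < z) :
    z ^ c * Real.exp z * ∑' n : ℕ, (-z) ^ n / Real.Gamma (c + n + 1)
      = (∫ y in (0 : ℝ)..z, y ^ (c - 1) * Real.exp y) / Real.Gamma c := by
  have t1 := ((summable_pow_div_Gamma hc (-z)).hasSum.tendsto_sum_nat).const_mul
    (z ^ c * Real.exp z)
  have t2 : Filter.Tendsto (fun N : ℕ => (-1 : ℝ) ^ N *
      ((∫ y in (0 : ℝ)..z, y ^ (c + N - 1) * Real.exp y) / Real.Gamma (c + N)))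
      Filter.atTop (nhds 0) := by
    have h0 := ((summable_pow_div_Gamma hc z).tendsto_atTop_zero).const_mul (z ^ c * Real.exp z)
    rw [mul_zero] at h0
    refine squeeze_zero_norm (fun N => ?_) h0
    have hcN : 0 < c + N := by positivity
    have hG : 0 < Real.Gamma (c + N) := Real.Gamma_pos_of_pos hcN
    obtain ⟨b1, b2⟩ := integral_rpow_mul_exp_bounds hcN hz
    rw [norm_mul, norm_pow, norm_neg, norm_one, one_pow, one_mul, Real.norm_eq_abs,
      abs_of_nonneg (div_nonneg b1 hG.le), Real.Gamma_add_one hcN.ne', div_le_iff₀ hG]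
    rw [Real.rpow_add hz, Real.rpow_natCast] at b2
    have : z ^ c * Real.exp z * (z ^ N / ((c + N) * Real.Gamma (c + N))) * Real.Gamma (c + N)
        = z ^ c * z ^ N * Real.exp z / (c + N) := by
      field_simp
    rw [this, le_div_iff₀ hcN]
    linarith
  refine tendsto_nhds_unique t1 ?_
  have t3 := t2.const_sub ((∫ y in (0 : ℝ)..z, y ^ (c - 1) * Real.exp y) / Real.Gamma c)
  rw [sub_zero] at t3
  refine t3.congr fun N => ?_
  rw [sum_range_pow_div_Gamma hc hz N]
  ring

lemma integrableOn_rpow_mul_exp_neg_mul {b y : ℝ} (hb : -1 < b) (hy : 0 < y) :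
    IntegrableOn (fun v : ℝ => v ^ b * Real.exp (-y * (v - 1))) (Set.Ioi 0) ∧
    ∫ v in Set.Ioi (0 : ℝ), v ^ b * Real.exp (-y * (v - 1))
      = Real.Gamma (b + 1) * (y ^ (-b - 1) * Real.exp y) := by
  have e (v : ℝ) : v ^ b * Real.exp (-y * (v - 1))
      = Real.exp y * (v ^ ((b + 1) - 1) * Real.exp (-(y * v))) := by
    rw [show -y * (v - 1) = y + -(y * v) by ring, Real.exp_add, add_sub_cancel_right]
    ring
  simp only [e]
  constructor
  · refine Integrable.const_mul ?_ _
    have := integrableOn_rpow_mul_exp_neg_mul_rpow hb one_pos hy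
    simp only [Real.rpow_one, neg_mul] at this
    simpa only [add_sub_cancel_right, IntegrableOn] using this
  · rw [integral_const_mul, Real.integral_rpow_mul_exp_neg_mul_Ioi (by linarith) hy, one_div,
      Real.inv_rpow hy.le, ← Real.rpow_neg hy.le, show -(b + 1) = -b - 1 by ring]
    ring

lemma integral_exp_neg_mul_const (w : ℝ) (hw : w ≠ 0) (z : ℝ) :
    ∫ y in (0 : ℝ)..z, Real.exp (-y * w) = -((Real.exp (-z * w) - 1) / w) := by
  have h : ∀ y ∈ Set.uIcc 0 z,
      HasDerivAt (fun y : ℝ => -(Real.exp (-y * w) / w)) (Real.exp (-y * w)) y := by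
    intro y _
    have := ((((hasDerivAt_id y).neg.mul_const w).exp).div_const w).neg
    refine this.congr_deriv ?_
    simp only [neg_one_mul, id_eq, Pi.neg_apply]
    field_simp
  rw [intervalIntegral.integral_eq_sub_of_hasDerivAt h
    (Continuous.intervalIntegrable (by fun_prop) _ _)]
  simp
  ring

lemma integral_rpow_mul_exp_sub_one_div {b z : ℝ} (hb : -1 < b) (hb0 : b < 0) (hz : 0 < z) :
    IntegrableOn (fun v : ℝ => v ^ b * (Real.exp (-z * (v - 1)) - 1) / (v - 1)) (Set.Ioi 0) ∧
    ∫ v in Set.Ioi (0 : ℝ), v ^ b * (Real.exp (-z * (v - 1)) - 1) / (v - 1)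
      = -(Real.Gamma (b + 1) * ∫ y in (0 : ℝ)..z, y ^ (-b - 1) * Real.exp y) := by
  have hf : Integrable (Function.uncurry fun (v y : ℝ) => v ^ b * Real.exp (-y * (v - 1)))
      ((volume.restrict (Set.Ioi 0)).prod (volume.restrict (Set.Ioc 0 z))) := by
    rw [integrable_prod_iff' (Measurable.aestronglyMeasurable (by unfold Function.uncurry; fun_prop))]
    constructor
    · filter_upwards [ae_restrict_mem measurableSet_Ioc] with y hy
      exact (integrableOn_rpow_mul_exp_neg_mul hb hy.1).1
    · have : IntegrableOn (fun y : ℝ => Real.Gamma (b + 1) * (y ^ (-b - 1) * Real.exp y))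
          (Set.Ioc 0 z) := by
        have := (intervalIntegrable_rpow_mul_exp (c := -b) (by linarith) z).const_mul
          (Real.Gamma (b + 1))
        rwa [intervalIntegrable_iff_integrableOn_Ioc_of_le hz.le] at this
      refine this.congr_fun (fun y hy => ?_) measurableSet_Ioc
      refine (integrableOn_rpow_mul_exp_neg_mul hb hy.1).2.symm.trans ?_
      refine setIntegral_congr_fun measurableSet_Ioi fun v hv => ?_
      exact (Real.norm_of_nonneg (mul_nonneg (Real.rpow_nonneg (le_of_lt hv) _)
        (Real.exp_pos _).le)).symm
  have hinner : ∀ v : ℝ, v ≠ 1 → ∫ y in Set.Ioc 0 z, v ^ b * Real.exp (-y * (v - 1))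
      = -(v ^ b * (Real.exp (-z * (v - 1)) - 1) / (v - 1)) := by
    intro v hv
    rw [← intervalIntegral.integral_of_le hz.le, intervalIntegral.integral_const_mul,
      integral_exp_neg_mul_const _ (sub_ne_zero.2 hv)]
    ring
  have hae : ∀ᵐ v ∂(volume.restrict (Set.Ioi (0 : ℝ))),
      ∫ y in Set.Ioc 0 z, v ^ b * Real.exp (-y * (v - 1))
      = -(v ^ b * (Real.exp (-z * (v - 1)) - 1) / (v - 1)) :=
    ae_restrict_of_ae ((Measure.ae_ne volume 1).mono hinner)
  constructor
  · have := (hf.integral_prod_left.congr hae).neg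
    exact this.congr (Filter.Eventually.of_forall fun v => neg_neg _)
  · have hs := integral_integral_swap hf
    rw [integral_congr_ae hae, integral_neg] at hs
    rw [← neg_eq_iff_eq_neg, hs, intervalIntegral.integral_of_le hz.le, ← integral_const_mul]
    exact setIntegral_congr_fun measurableSet_Ioc fun y hy =>
      (integrableOn_rpow_mul_exp_neg_mul hb hy.1).2

/-- The principal value of `∫₀^∞ v^a e^(-z(v-1)) / (v-1) dv`, regularised by `v^(-1/2)`,
whose own principal value vanishes. -/
lemma pv_integral_base {b z : ℝ} (hb : -1 < b) (hb0 : b < 0) (hz : 0 < z) :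
    IntegrableOn (fun v : ℝ => (v ^ b * Real.exp (-z * (v - 1)) - v ^ (-(1 / 2) : ℝ)) / (v - 1))
      (Set.Ioi 0) ∧
    Real.sin (Real.pi * b) * ∫ v in Set.Ioi (0 : ℝ),
        (v ^ b * Real.exp (-z * (v - 1)) - v ^ (-(1 / 2) : ℝ)) / (v - 1)
      = Real.pi * (z ^ (-b) * (Real.exp z * ∑' n : ℕ, (-z) ^ n / Real.Gamma (-b + n + 1))
        - Real.cos (Real.pi * b)) := by
  obtain ⟨i1, e1⟩ := integral_rpow_mul_exp_sub_one_div hb hb0 hz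
  have i2 := (integrableOn_Ioi_rpow_sub_div hb hb0).1
  have e2 := sin_mul_integral_rpow_sub_div hb hb0
  have e (v : ℝ) : (v ^ b * Real.exp (-z * (v - 1)) - v ^ (-(1 / 2) : ℝ)) / (v - 1)
      = v ^ b * (Real.exp (-z * (v - 1)) - 1) / (v - 1)
        + (v ^ b - v ^ (-(1 / 2) : ℝ)) / (v - 1) := by ring
  simp only [e]
  refine ⟨i1.add i2, ?_⟩
  rw [integral_add i1 i2, mul_add, e2, e1, ← mul_assoc (z ^ (-b)),
    tsum_pow_div_Gamma (c := -b) (by linarith) hz]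
  have hG : 0 < Real.Gamma (-b) := Real.Gamma_pos_of_pos (by linarith)
  have hrefl := Real.Gamma_mul_Gamma_one_sub (-b)
  have hsin : Real.sin (Real.pi * b) < 0 :=
    Real.sin_neg_of_neg_of_neg_pi_lt (by nlinarith [Real.pi_pos]) (by nlinarith [Real.pi_pos])
  rw [show 1 - -b = b + 1 by ring, mul_neg, Real.sin_neg] at hrefl
  have hG2 : Real.Gamma (b + 1) = Real.pi / -Real.sin (Real.pi * b) / Real.Gamma (-b) := by
    rw [← hrefl]
    field_simp
  rw [hG2]
  have := hsin.ne
  field_simp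
  ring

lemma integrableOn_exp_sub_rpow_div {z : ℝ} (hz : 0 < z) :
    IntegrableOn (fun v : ℝ => (v ^ (0 : ℝ) * Real.exp (-z * (v - 1)) - v ^ (-(1 / 2) : ℝ)) / (v - 1))
      (Set.Ioi 0) := by
  have i1 := (pv_integral_base (b := -(1 / 2)) (by norm_num) (by norm_num) hz).1
  have i2 : IntegrableOn (fun v : ℝ => (1 - v ^ (-(1 / 2) : ℝ)) * Real.exp (-z * (v - 1)) / (v - 1))
      (Set.Ioi 0) := by
    refine Integrable.mono' (integrableOn_rpow_mul_exp_neg_mul (b := -(1 / 2)) (by norm_num) hz).1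
      (Measurable.aestronglyMeasurable (by fun_prop)) ?_
    filter_upwards [ae_restrict_mem measurableSet_Ioi,
      ae_restrict_of_ae (Measure.ae_ne volume (1 : ℝ))] with v hv hv1
    have hv0 : 0 < v := hv
    have hs := Real.sqrt_pos.2 hv0
    have hs1 : Real.sqrt v - 1 ≠ 0 := fun h => hv1 (by
      rw [← Real.sq_sqrt hv0.le, show Real.sqrt v = 1 by linarith, one_pow])
    have e : (1 - v ^ (-(1 / 2) : ℝ)) * Real.exp (-z * (v - 1)) / (v - 1)
        = v ^ (-(1 / 2) : ℝ) * Real.exp (-z * (v - 1)) * (Real.sqrt v + 1)⁻¹ := by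
      rw [Real.rpow_neg hv0.le, ← Real.sqrt_eq_rpow]
      have e2 : v - 1 = (Real.sqrt v - 1) * (Real.sqrt v + 1) := by
        nlinarith [Real.sq_sqrt hv0.le]
      generalize Real.exp (-z * (v - 1)) = E
      rw [e2]
      field_simp
    rw [e, Real.norm_of_nonneg (by positivity)]
    refine mul_le_of_le_one_right (by positivity) (inv_le_one_of_one_le₀ (by linarith))
  refine (i1.add i2).congr_fun (fun v _ => ?_) measurableSet_Ioi
  simp only [Pi.add_apply, Real.rpow_zero]
  ring

/-- Evaluation of the regularised principal value of `∫₀^∞ v^a e^(-z(v-1)) / (v-1) dv`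
in terms of the series defining `gammaStar (-a) (-z)`. -/
def PVEvaluation (a z : ℝ) : Prop :=
  Summable (fun n : ℕ => (-z) ^ n / Real.Gamma (-a + n + 1)) ∧
  IntegrableOn (fun v : ℝ => (v ^ a * Real.exp (-z * (v - 1)) - v ^ (-(1 / 2) : ℝ)) / (v - 1))
    (Set.Ioi 0) ∧
  Real.sin (Real.pi * a) * ∫ v in Set.Ioi (0 : ℝ),
      (v ^ a * Real.exp (-z * (v - 1)) - v ^ (-(1 / 2) : ℝ)) / (v - 1)
    = Real.pi * (z ^ (-a) * (Real.exp z * ∑' n : ℕ, (-z) ^ n / Real.Gamma (-a + n + 1))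
      - Real.cos (Real.pi * a))

lemma PVEvaluation.base {b z : ℝ} (hb : -1 < b) (hb0 : b ≤ 0) (hz : 0 < z) :
    PVEvaluation b z := by
  rcases hb0.lt_or_eq with hb0 | rfl
  · exact ⟨summable_pow_div_Gamma (by linarith) _, pv_integral_base hb hb0 hz⟩
  · have e (n : ℕ) : (-z) ^ n / Real.Gamma (-0 + n + 1) = (-z) ^ n / n.factorial := by
      rw [neg_zero, zero_add, Real.Gamma_nat_eq_factorial]
    refine ⟨?_, integrableOn_exp_sub_rpow_div hz, ?_⟩
    · simpa only [e] using Real.summable_pow_div_factorial (-z)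
    · simp only [e]
      have h := (NormedSpace.expSeries_div_hasSum_exp (-z)).tsum_eq
      rw [← Real.exp_eq_exp_ℝ] at h
      rw [h, ← Real.exp_add]
      simp

lemma inv_Gamma_neg (a : ℝ) (ha : -1 < a) :
    1 / Real.Gamma (-a) = -(Real.sin (Real.pi * a) * Real.Gamma (a + 1) / Real.pi) := by
  have hG : Real.Gamma (a + 1) ≠ 0 := (Real.Gamma_pos_of_pos (by linarith)).ne'
  have h := Real.Gamma_mul_Gamma_one_sub (-a)
  rw [show 1 - -a = a + 1 by ring, mul_neg, Real.sin_neg] at h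
  have h2 : Real.Gamma (-a) = Real.pi / -Real.sin (Real.pi * a) / Real.Gamma (a + 1) := by
    rw [← h]
    field_simp
  rw [h2, one_div_div, div_div_eq_mul_div]
  ring

lemma PVEvaluation.succ {a z : ℝ} (ha : -1 < a) (hz : 0 < z) (h : PVEvaluation a z) :
    PVEvaluation (a + 1) z := by
  obtain ⟨hs, hi, he⟩ := h
  obtain ⟨j1, j2⟩ := integrableOn_rpow_mul_exp_neg_mul ha hz
  have es (n : ℕ) : (-z) ^ (n + 1) / Real.Gamma (-(a + 1) + ((n + 1 : ℕ) : ℝ) + 1)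
      = -z * ((-z) ^ n / Real.Gamma (-a + n + 1)) := by
    rw [pow_succ, show -(a + 1) + ((n + 1 : ℕ) : ℝ) + 1 = -a + n + 1 by push_cast; ring]
    ring
  have hs' : Summable (fun n : ℕ => (-z) ^ n / Real.Gamma (-(a + 1) + n + 1)) := by
    rw [← summable_nat_add_iff 1]
    simp only [es]
    exact hs.mul_left _
  have hint : ∀ᵐ v ∂(volume.restrict (Set.Ioi (0 : ℝ))),
      (v ^ a * Real.exp (-z * (v - 1)) - v ^ (-(1 / 2) : ℝ)) / (v - 1)
        + v ^ a * Real.exp (-z * (v - 1))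
      = (v ^ (a + 1) * Real.exp (-z * (v - 1)) - v ^ (-(1 / 2) : ℝ)) / (v - 1) := by
    filter_upwards [ae_restrict_mem measurableSet_Ioi,
      ae_restrict_of_ae (Measure.ae_ne volume (1 : ℝ))] with v hv hv1
    rw [Real.rpow_add_one (ne_of_gt hv)]
    have : v - 1 ≠ 0 := sub_ne_zero.2 hv1
    field_simp
    ring
  refine ⟨hs', (hi.add j1).congr hint, ?_⟩
  rw [← integral_congr_ae hint, integral_add hi j1, hs'.tsum_eq_zero_add]
  simp only [es]
  rw [tsum_mul_left, j2, mul_add (Real.pi) a 1, mul_one, Real.sin_add_pi, Real.cos_add_pi,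
    neg_mul, mul_add, he, pow_zero,
    show -(a + 1) + ((0 : ℕ) : ℝ) + 1 = -a by simp, inv_Gamma_neg a ha,
    show -(a + 1) = -a - 1 by ring, Real.rpow_sub_one hz.ne' (-a)]
  have := Real.pi_ne_zero
  field_simp
  ring

lemma pvEvaluation {a z : ℝ} (ha : 0 < a) (hz : 0 < z) : PVEvaluation a z := by
  have key (k : ℕ) {b : ℝ} (hb : -1 < b) (hb0 : b ≤ 0) : PVEvaluation (b + k) z := by
    induction k with
    | zero => simpa using PVEvaluation.base hb hb0 hz
    | succ k ih =>
      have hk : (0 : ℝ) ≤ k := k.cast_nonneg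
      rw [Nat.cast_succ, ← add_assoc]
      exact ih.succ (by linarith) hz
  have h := key ⌈a⌉₊ (b := a - ⌈a⌉₊) (by linarith [Nat.ceil_lt_add_one ha.le])
    (by linarith [Nat.le_ceil a])
  rwa [sub_add_cancel] at h

lemma gammaStar_neg_ofReal (a z : ℝ) :
    gammaStar (-(a : ℂ)) (-(z : ℂ))
      = ((Real.exp z * ∑' n : ℕ, (-z) ^ n / Real.Gamma (-a + n + 1) : ℝ) : ℂ) := by
  rw [gammaStar, Complex.ofReal_mul, Complex.ofReal_tsum, neg_neg, Complex.ofReal_exp]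
  congr 2
  funext n
  push_cast [← Complex.Gamma_ofReal]
  rfl

lemma integral_gaussian_mul_exp {a : ℝ} (ha : 0 < a) (y : ℝ) :
    Integrable (fun u : ℝ => Real.exp (-a * u ^ 2 / 2) * Real.exp (-y * (a * u))) ∧
    ∫ u : ℝ, Real.exp (-a * u ^ 2 / 2) * Real.exp (-y * (a * u))
      = Real.sqrt (2 * Real.pi / a) * Real.exp (a * y ^ 2 / 2) := by
  have e (u : ℝ) : Real.exp (-a * u ^ 2 / 2) * Real.exp (-y * (a * u))
      = Real.exp (a * y ^ 2 / 2) * Real.exp (-(a / 2) * (u + y) ^ 2) := by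
    rw [← Real.exp_add, ← Real.exp_add]
    congr 1
    ring
  simp only [e]
  refine ⟨((integrable_exp_neg_mul_sq (half_pos ha)).comp_add_right y).const_mul _, ?_⟩
  rw [integral_const_mul, integral_add_right_eq_self (fun u => Real.exp (-(a / 2) * u ^ 2)) y,
    integral_gaussian, mul_comm, show Real.pi / (a / 2) = 2 * Real.pi / a by field_simp]

lemma integral_gaussian_mul_exp_sub_one_div {a : ℝ} (ha : 0 < a) (η : ℝ) :
    Integrable (fun u : ℝ => Real.exp (-a * u ^ 2 / 2) * (Real.exp (-η * (a * u)) - 1) / u) ∧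
    ∫ u : ℝ, Real.exp (-a * u ^ 2 / 2) * (Real.exp (-η * (a * u)) - 1) / u
      = -(a * Real.sqrt (2 * Real.pi / a) * ∫ y in (0 : ℝ)..η, Real.exp (a * y ^ 2 / 2)) := by
  have hf : Integrable
      (Function.uncurry fun (u y : ℝ) => Real.exp (-a * u ^ 2 / 2) * Real.exp (-y * (a * u)))
      ((volume : Measure ℝ).prod (volume.restrict (Set.uIoc 0 η))) := by
    rw [integrable_prod_iff' (Measurable.aestronglyMeasurable (by unfold Function.uncurry; fun_prop))]
    constructor
    · exact Filter.Eventually.of_forall fun y => (integral_gaussian_mul_exp ha y).1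
    · have h1 : IntervalIntegrable
          (fun y => Real.sqrt (2 * Real.pi / a) * Real.exp (a * y ^ 2 / 2)) volume 0 η :=
        Continuous.intervalIntegrable (by fun_prop) _ _
      refine (intervalIntegrable_iff.1 h1).congr_fun (fun y _ => ?_) measurableSet_uIoc
      refine (integral_gaussian_mul_exp ha y).2.symm.trans ?_
      exact integral_congr_ae (Filter.Eventually.of_forall fun u =>
        (Real.norm_of_nonneg (by positivity)).symm)
  have hinner : ∀ u : ℝ, u ≠ 0 →
      ∫ y in (0 : ℝ)..η, Real.exp (-a * u ^ 2 / 2) * Real.exp (-y * (a * u))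
      = -(1 / a) * (Real.exp (-a * u ^ 2 / 2) * (Real.exp (-η * (a * u)) - 1) / u) := by
    intro u hu
    rw [intervalIntegral.integral_const_mul, integral_exp_neg_mul_const _ (mul_ne_zero ha.ne' hu)]
    field_simp
  have hsw := integral_integral_swap hf
  have hII := hf.integral_prod_left
  have hae : ∀ᵐ u : ℝ, ∫ y in (0 : ℝ)..η, Real.exp (-a * u ^ 2 / 2) * Real.exp (-y * (a * u))
      = -(1 / a) * (Real.exp (-a * u ^ 2 / 2) * (Real.exp (-η * (a * u)) - 1) / u) :=
    (Measure.ae_ne volume 0).mono hinner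
  simp only [Function.uncurry] at hII
  have hc : -(1 / a) ≠ 0 := neg_ne_zero.2 (one_div_ne_zero ha.ne')
  simp only [intervalIntegral.intervalIntegral_eq_integral_uIoc] at hae ⊢
  constructor
  · have h2 := (hII.smul (if (0:ℝ) ≤ η then (1:ℝ) else -1)).congr hae
    exact (integrable_const_mul_iff (isUnit_iff_ne_zero.2 hc) _).1 h2
  · have h3 := integral_congr_ae hae
    rw [integral_smul, hsw, integral_const_mul] at h3
    simp only [(integral_gaussian_mul_exp ha _).2] at h3
    rw [integral_const_mul] at h3
    simp only [smul_eq_mul] at h3 ⊢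
    have h4 : ∀ x y : ℝ, x = -(1 / a) * y → y = -(a * x) := by
      intro x y h
      rw [h]
      field_simp
    rw [h4 _ _ h3]
    ring

lemma dawson_mul_sqrt {a : ℝ} (ha : 0 < a) (η : ℝ) :
    dawson (η * Real.sqrt (a / 2)) = Real.exp (-a * η ^ 2 / 2) *
      (Real.sqrt (a / 2) * ∫ y in (0 : ℝ)..η, Real.exp (a * y ^ 2 / 2)) := by
  have hs : Real.sqrt (a / 2) ^ 2 = a / 2 := Real.sq_sqrt (by positivity)
  have hs0 : Real.sqrt (a / 2) ≠ 0 := (Real.sqrt_pos.2 (by positivity)).ne'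
  rw [dawson]
  congr 1
  · rw [mul_pow, hs]
    congr 1
    ring
  · have h := intervalIntegral.integral_comp_mul_right (a := 0) (b := η)
      (fun t => Real.exp (t ^ 2)) hs0
    rw [zero_mul] at h
    have e (y : ℝ) : Real.exp (a * y ^ 2 / 2) = Real.exp ((y * Real.sqrt (a / 2)) ^ 2) := by
      rw [mul_pow, hs]
      congr 1
      ring
    simp only [e]
    rw [h, smul_eq_mul, mul_inv_cancel_left₀ hs0]

lemma integrable_gaussian_sub_inv_div {a : ℝ} (ha : 0 < a) :
    Integrable (fun u : ℝ => (Real.exp (-a * u ^ 2 / 2) - (1 + u ^ 2)⁻¹) / u) := by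
  have hg : Integrable (fun u : ℝ => Real.exp (-a * u ^ 2 / 2)) := by
    convert integrable_exp_neg_mul_sq (half_pos ha) using 3
    ring
  refine Integrable.mono' (hg.add (integrable_inv_one_add_sq.const_mul (a + 3)))
    (Measurable.aestronglyMeasurable (by fun_prop)) (Filter.Eventually.of_forall fun u => ?_)
  have hu2 : 0 ≤ u ^ 2 := sq_nonneg u
  have hE := Real.exp_pos (-a * u ^ 2 / 2)
  have hI : 0 < (1 + u ^ 2)⁻¹ := by positivity
  rw [Real.norm_eq_abs, abs_div]
  simp only [Pi.add_apply]
  rcases le_or_gt |u| 1 with h | h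
  · rcases eq_or_ne u 0 with rfl | hu
    · simp
      linarith
    · have hup : 0 < |u| := abs_pos.2 hu
      have h1 : |Real.exp (-a * u ^ 2 / 2) - (1 + u ^ 2)⁻¹| ≤ (a / 2 + 1) * u ^ 2 := by
        have b1 : Real.exp (-a * u ^ 2 / 2) ≤ 1 := Real.exp_le_one_iff.2 (by nlinarith)
        have b2 := Real.add_one_le_exp (-a * u ^ 2 / 2)
        have b3 : (1 + u ^ 2)⁻¹ ≤ 1 := inv_le_one_of_one_le₀ (by linarith)
        have b4 : 1 - u ^ 2 ≤ (1 + u ^ 2)⁻¹ := by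
          rw [← one_div, le_div_iff₀ (by positivity)]
          nlinarith [sq_nonneg (u ^ 2)]
        rw [abs_le]
        constructor <;> nlinarith
      have h2 : (1 / 2 : ℝ) ≤ (1 + u ^ 2)⁻¹ := by
        rw [one_div]
        gcongr
        nlinarith [sq_abs u]
      calc |Real.exp (-a * u ^ 2 / 2) - (1 + u ^ 2)⁻¹| / |u|
          ≤ (a / 2 + 1) * u ^ 2 / |u| := by gcongr
        _ = (a / 2 + 1) * |u| := by rw [← sq_abs]; field_simp
        _ ≤ (a / 2 + 1) * 1 := by gcongr
        _ ≤ _ := by nlinarith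
  · calc |Real.exp (-a * u ^ 2 / 2) - (1 + u ^ 2)⁻¹| / |u|
        ≤ |Real.exp (-a * u ^ 2 / 2) - (1 + u ^ 2)⁻¹| := div_le_self (abs_nonneg _) h.le
      _ ≤ Real.exp (-a * u ^ 2 / 2) + (1 + u ^ 2)⁻¹ := by
        rw [abs_le]
        constructor <;> linarith
      _ ≤ _ := by nlinarith

lemma integral_gaussian_sub_inv_div (a : ℝ) :
    ∫ u : ℝ, (Real.exp (-a * u ^ 2 / 2) - (1 + u ^ 2)⁻¹) / u = 0 := by
  have h := integral_neg_eq_self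
    (fun u : ℝ => (Real.exp (-a * u ^ 2 / 2) - (1 + u ^ 2)⁻¹) / u) volume
  simp only [neg_sq, div_neg, integral_neg] at h
  linarith

lemma sub_log_strictMonoOn : StrictMonoOn (fun s : ℝ => s - Real.log s - 1) (Set.Ici 1) := by
  intro s hs t _ hst
  have hs1 : (1 : ℝ) ≤ s := hs
  have h0 : 0 < s := by linarith
  have h1 := Real.log_lt_sub_one_of_pos (div_pos (h0.trans hst) h0) (div_ne_one_of_ne hst.ne')
  rw [Real.log_div (h0.trans hst).ne' h0.ne'] at h1
  have h2 : t / s - 1 ≤ t - s := by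
    rw [div_sub_one h0.ne']
    exact div_le_self (by linarith) hs1
  simp only
  linarith

lemma sub_log_strictAntiOn : StrictAntiOn (fun s : ℝ => s - Real.log s - 1) (Set.Ioc 0 1) := by
  intro s hs t ht hst
  have h0 : 0 < t := ht.1
  have h1 := Real.log_lt_sub_one_of_pos (div_pos hs.1 h0) (div_ne_one_of_ne hst.ne)
  rw [Real.log_div hs.1.ne' h0.ne'] at h1
  have h2 : s / t - 1 ≤ s - t := by
    rw [div_sub_one h0.ne', div_le_iff₀ h0]
    nlinarith [ht.2]
  simp only
  linarith

/-- `t` inverts the map `s ↦ sign (s - 1) √(2 (s - log s - 1))` of `(0, ∞)` onto `ℝ`. -/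
structure IsZetaInverse (t : ℝ → ℝ) : Prop where
  pos : ∀ x, 0 < t x
  sub_log : ∀ x, t x - Real.log (t x) - 1 = x ^ 2 / 2
  one_lt : ∀ x, 0 < x → 1 < t x
  lt_one : ∀ x, x < 0 → t x < 1
  surj : ∀ s, 0 < s → ∃ x, t x = s

lemma IsZetaInverse.of_inverse {zeta t : ℝ → ℝ}
    (hzeta : ∀ s : ℝ, zeta s = Real.sign (s - 1) * Real.sqrt (2 * (s - Real.log s - 1)))
    (hpos : ∀ x : ℝ, 0 < t x) (hleft : ∀ s : ℝ, 0 < s → t (zeta s) = s)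
    (hright : ∀ x : ℝ, zeta (t x) = x) : IsZetaInverse t := by
  refine ⟨hpos, fun x => ?_, fun x hx => ?_, fun x hx => ?_, fun s hs => ⟨_, hleft s hs⟩⟩
  · have h := hright x
    rw [hzeta] at h
    have h0 : 0 ≤ 2 * (t x - Real.log (t x) - 1) := by
      linarith [Real.log_le_sub_one_of_pos (hpos x)]
    rcases eq_or_ne (t x) 1 with h1 | h1
    · rw [h1] at h ⊢
      simp at h ⊢
      simp [← h]
    · have hsq : Real.sign (t x - 1) ^ 2 = 1 := by
        rcases Real.sign_apply_eq_of_ne_zero _ (sub_ne_zero.2 h1) with h | h <;> rw [h] <;> norm_num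
      have h3 := congrArg (· ^ 2) h
      simp only [mul_pow, hsq, Real.sq_sqrt h0] at h3
      linarith
  · by_contra! hc
    have h := hright x
    rw [hzeta] at h
    have : Real.sign (t x - 1) ≤ 0 := by
      rcases hc.lt_or_eq with h1 | h1
      · rw [Real.sign_of_neg (by linarith)]
        norm_num
      · simp [h1]
    nlinarith [Real.sqrt_nonneg (2 * (t x - Real.log (t x) - 1))]
  · by_contra! hc
    have h := hright x
    rw [hzeta] at h
    have : 0 ≤ Real.sign (t x - 1) := by
      rcases hc.lt_or_eq with h1 | h1
      · rw [Real.sign_of_pos (by linarith)]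
        norm_num
      · simp [← h1]
    nlinarith [Real.sqrt_nonneg (2 * (t x - Real.log (t x) - 1))]

lemma IsZetaInverse.map_zero {t : ℝ → ℝ} (ht : IsZetaInverse t) : t 0 = 1 := by
  obtain ⟨x, hx⟩ := ht.surj 1 one_pos
  rcases lt_trichotomy x 0 with h | rfl | h
  · exact absurd hx (ht.lt_one x h).ne
  · exact hx
  · exact absurd hx (ht.one_lt x h).ne'

lemma IsZetaInverse.strictMono {t : ℝ → ℝ} (ht : IsZetaInverse t) : StrictMono t := by
  intro x y hxy
  have h1 {x : ℝ} (hx : 0 ≤ x) : 1 ≤ t x := by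
    rcases hx.lt_or_eq with h | rfl
    · exact (ht.one_lt x h).le
    · exact ht.map_zero.ge
  have h2 {x : ℝ} (hx : x ≤ 0) : t x ∈ Set.Ioc 0 1 := by
    refine ⟨ht.pos x, ?_⟩
    rcases hx.lt_or_eq with h | rfl
    · exact (ht.lt_one x h).le
    · exact ht.map_zero.le
  rcases le_or_gt 0 x with hx | hx
  · refine (sub_log_strictMonoOn.lt_iff_lt (h1 hx) (h1 (hx.trans hxy.le))).1 ?_
    simp only [ht.sub_log]
    nlinarith
  · rcases le_or_gt y 0 with hy | hy
    · refine (sub_log_strictAntiOn.lt_iff_gt (h2 hy) (h2 hx.le)).1 ?_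
      simp only [ht.sub_log]
      nlinarith
    · exact (ht.lt_one x hx).trans (ht.one_lt y hy)

lemma IsZetaInverse.continuous {t : ℝ → ℝ} (ht : IsZetaInverse t) : Continuous t := by
  have h : Continuous fun x => Real.log (t x) := by
    refine Monotone.continuous_of_surjective
      (fun x y hxy => Real.log_le_log (ht.pos x) (ht.strictMono.monotone hxy)) fun s => ?_
    obtain ⟨x, hx⟩ := ht.surj (Real.exp s) (Real.exp_pos s)
    exact ⟨x, by simp only [hx, Real.log_exp]⟩
  refine (Real.continuous_exp.comp h).congr fun x => ?_
  exact Real.exp_log (ht.pos x)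

lemma IsZetaInverse.ne_one {t : ℝ → ℝ} (ht : IsZetaInverse t) {x : ℝ} (hx : x ≠ 0) :
    t x ≠ 1 := by
  rw [← ht.map_zero]
  exact ht.strictMono.injective.ne hx

lemma IsZetaInverse.deriv_pos {t : ℝ → ℝ} (ht : IsZetaInverse t) {x : ℝ} (hx : x ≠ 0) :
    0 < x * t x / (t x - 1) := by
  rcases hx.lt_or_gt with h | h
  · exact div_pos_of_neg_of_neg (mul_neg_of_neg_of_pos h (ht.pos x))
      (sub_neg.2 (ht.lt_one x h))
  · exact div_pos (mul_pos h (ht.pos x)) (sub_pos.2 (ht.one_lt x h))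

lemma IsZetaInverse.hasDerivAt {t : ℝ → ℝ} (ht : IsZetaInverse t) {x : ℝ} (hx : x ≠ 0) :
    HasDerivAt t (x * t x / (t x - 1)) x := by
  have hsg : SignType.sign x * |x| = x := sign_mul_abs x
  have hx0 : |x| ≠ 0 := abs_ne_zero.2 hx
  have ht0 := (ht.pos x).ne'
  have ht1 := sub_ne_zero.2 (ht.ne_one hx)
  have hφ : HasDerivAt (fun s : ℝ => 2 * (s - Real.log s - 1)) (2 * (1 - (t x)⁻¹)) (t x) :=
    (((hasDerivAt_id _).sub (Real.hasDerivAt_log ht0)).sub_const 1).const_mul 2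
  have e (y : ℝ) : 2 * (t y - Real.log (t y) - 1) = y ^ 2 := by
    rw [ht.sub_log]
    ring
  have hf := (hφ.sqrt (by rw [e]; exact pow_ne_zero 2 hx)).const_mul (SignType.sign x : ℝ)
  rw [e, Real.sqrt_sq_eq_abs] at hf
  have h := HasDerivAt.of_local_left_inverse ht.continuous.continuousAt hf ?_ ?_
  · have e2 : x * t x / (t x - 1) = ((SignType.sign x : ℝ) * (2 * (1 - (t x)⁻¹) / (2 * |x|)))⁻¹ := by
      rcases hx.lt_or_gt with h | h
      · simp only [sign_neg h, abs_of_neg h]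
        simp
        field_simp
      · simp only [sign_pos h, abs_of_pos h]
        simp
        field_simp
    rw [e2]
    exact h
  · have : (SignType.sign x : ℝ) ≠ 0 := by
      rcases hx.lt_or_gt with h | h <;> simp [sign_neg, sign_pos, h]
    have h3 : 1 - (t x)⁻¹ ≠ 0 := by
      rw [show 1 - (t x)⁻¹ = (t x - 1) / t x by field_simp]
      exact div_ne_zero ht1 ht0
    positivity
  · rcases hx.lt_or_gt with h | h
    · filter_upwards [gt_mem_nhds h] with y hy
      rw [e, Real.sqrt_sq_eq_abs, sign_neg h, abs_of_neg hy]
      simp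
    · filter_upwards [lt_mem_nhds h] with y hy
      rw [e, Real.sqrt_sq_eq_abs, sign_pos h, abs_of_pos hy]
      simp

lemma IsZetaInverse.tendsto_atTop {t : ℝ → ℝ} (ht : IsZetaInverse t) :
    Filter.Tendsto t Filter.atTop Filter.atTop := by
  refine Filter.tendsto_atTop_atTop_of_monotone ht.strictMono.monotone fun b => ?_
  obtain ⟨x, hx⟩ := ht.surj (|b| + 1) (by positivity)
  exact ⟨x, by linarith [le_abs_self b]⟩

lemma IsZetaInverse.tendsto_atBot {t : ℝ → ℝ} (ht : IsZetaInverse t) :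
    Filter.Tendsto t Filter.atBot (nhds 0) := by
  rw [tendsto_order]
  refine ⟨fun b hb => Filter.Eventually.of_forall fun x => hb.trans (ht.pos x), fun b hb => ?_⟩
  obtain ⟨x, rfl⟩ := ht.surj b hb
  filter_upwards [Filter.eventually_lt_atBot x] with y hy
  exact ht.strictMono hy

lemma IsZetaInverse.image_compl {t : ℝ → ℝ} (ht : IsZetaInverse t) :
    t '' {0}ᶜ = Set.Ioi 0 \ {1} := by
  ext s
  constructor
  · rintro ⟨x, hx, rfl⟩
    exact ⟨ht.pos x, ht.ne_one hx⟩
  · rintro ⟨hs, hs1⟩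
    obtain ⟨x, rfl⟩ := ht.surj s hs
    exact ⟨x, fun h => hs1 (by rw [Set.mem_singleton_iff.1 h]; exact ht.map_zero), rfl⟩

lemma IsZetaInverse.integrable_comp_iff {t : ℝ → ℝ} (ht : IsZetaInverse t) (F : ℝ → ℝ) :
    Integrable (fun x => x * t x / (t x - 1) * F (t x)) ↔ IntegrableOn F (Set.Ioi 0) := by
  have h := integrableOn_image_iff_integrableOn_abs_deriv_smul (s := {0}ᶜ)
    (MeasurableSet.singleton (0 : ℝ)).compl
    (fun x hx => (ht.hasDerivAt hx).hasDerivWithinAt) ht.strictMono.injective.injOn F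
  rw [ht.image_compl, integrableOn_congr_set_ae (sdiff_null_ae_eq_self (by simp))] at h
  rw [h, ← integrableOn_univ, ← integrableOn_congr_set_ae (s := {0}ᶜ) (t := Set.univ)
    (by simp [ae_eq_univ])]
  refine integrableOn_congr_fun (fun x hx => ?_) (MeasurableSet.singleton (0 : ℝ)).compl
  rw [abs_of_pos (ht.deriv_pos hx), smul_eq_mul]

lemma IsZetaInverse.integral_comp {t : ℝ → ℝ} (ht : IsZetaInverse t) (F : ℝ → ℝ) :
    ∫ x, x * t x / (t x - 1) * F (t x) = ∫ s in Set.Ioi 0, F s := by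
  have h := integral_image_eq_integral_abs_deriv_smul (s := {0}ᶜ)
    (MeasurableSet.singleton (0 : ℝ)).compl
    (fun x hx => (ht.hasDerivAt hx).hasDerivWithinAt) ht.strictMono.injective.injOn F
  rw [ht.image_compl, setIntegral_congr_set (sdiff_null_ae_eq_self (by simp))] at h
  rw [h, ← setIntegral_univ, ← setIntegral_congr_set (s := {0}ᶜ) (t := Set.univ)
    (by simp [ae_eq_univ])]
  refine setIntegral_congr_fun (MeasurableSet.singleton (0 : ℝ)).compl fun x hx => ?_
  rw [abs_of_pos (ht.deriv_pos hx), smul_eq_mul]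

lemma exp_neg_mul_sub_log {a s : ℝ} (hs : 0 < s) :
    Real.exp (-a * (s - Real.log s - 1)) = s ^ a * Real.exp (-a * (s - 1)) := by
  rw [Real.rpow_def_of_pos hs, ← Real.exp_add]
  congr 1
  ring

lemma integral_exp_sub_log_sub_div {a lam : ℝ} (ha : 0 < a) (hlam : 0 < lam) :
    IntegrableOn (fun s : ℝ => (Real.exp (-a * (s - Real.log s - 1))
        - Real.exp (-a * (lam - Real.log lam - 1)) * (s / lam) ^ (-(1 / 2) : ℝ)) / (s - lam))
      (Set.Ioi 0) ∧
    ∫ s in Set.Ioi (0 : ℝ), (Real.exp (-a * (s - Real.log s - 1))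
        - Real.exp (-a * (lam - Real.log lam - 1)) * (s / lam) ^ (-(1 / 2) : ℝ)) / (s - lam)
      = Real.exp (-a * (lam - Real.log lam - 1)) * ∫ v in Set.Ioi (0 : ℝ),
        (v ^ a * Real.exp (-(a * lam) * (v - 1)) - v ^ (-(1 / 2) : ℝ)) / (v - 1) := by
  have hi := (pvEvaluation ha (mul_pos ha hlam)).2.1
  set F : ℝ → ℝ := fun s : ℝ => (Real.exp (-a * (s - Real.log s - 1))
        - Real.exp (-a * (lam - Real.log lam - 1)) * (s / lam) ^ (-(1 / 2) : ℝ)) / (s - lam)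
  have e : Set.EqOn (fun v => F (lam * v)) (fun v => lam⁻¹ *
      (Real.exp (-a * (lam - Real.log lam - 1)) *
      ((v ^ a * Real.exp (-(a * lam) * (v - 1)) - v ^ (-(1 / 2) : ℝ)) / (v - 1)))) (Set.Ioi 0) := by
    intro v hv
    have hv0 : 0 < v := hv
    simp only [F]
    rw [mul_div_cancel_left₀ _ hlam.ne', exp_neg_mul_sub_log (mul_pos hlam hv0),
      exp_neg_mul_sub_log hlam, Real.mul_rpow hlam.le hv0.le,
      show -a * (lam * v - 1) = -a * (lam - 1) + -(a * lam) * (v - 1) by ring, Real.exp_add,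
      show lam * v - lam = lam * (v - 1) by ring, ← div_div]
    generalize Real.exp (-a * (lam - 1)) = E
    field_simp
  constructor
  · have h := (integrableOn_Ioi_comp_mul_left_iff F 0 hlam).1
    rw [mul_zero] at h
    refine h (IntegrableOn.congr_fun ?_ e.symm measurableSet_Ioi)
    exact (hi.const_mul _).const_mul _
  · have h := integral_comp_mul_left_Ioi F 0 hlam
    rw [mul_zero, setIntegral_congr_fun measurableSet_Ioi e, integral_const_mul,
      integral_const_mul, smul_eq_mul] at h
    exact (mul_left_cancel₀ (inv_ne_zero hlam.ne') h).symm

lemma IsZetaInverse.integral_pv {t : ℝ → ℝ} (ht : IsZetaInverse t) {a : ℝ} (ha : 0 < a) (η : ℝ) :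
    Integrable (fun x => x * t x / (t x - 1) * ((Real.exp (-a * x ^ 2 / 2)
        - Real.exp (-a * η ^ 2 / 2) * (t x / t η) ^ (-(1 / 2) : ℝ)) / (t x - t η))) ∧
    ∫ x, x * t x / (t x - 1) * ((Real.exp (-a * x ^ 2 / 2)
        - Real.exp (-a * η ^ 2 / 2) * (t x / t η) ^ (-(1 / 2) : ℝ)) / (t x - t η))
      = Real.exp (-a * η ^ 2 / 2) * ∫ v in Set.Ioi (0 : ℝ),
        (v ^ a * Real.exp (-(a * t η) * (v - 1)) - v ^ (-(1 / 2) : ℝ)) / (v - 1) := by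
  obtain ⟨h1, h2⟩ := integral_exp_sub_log_sub_div ha (ht.pos η)
  have e (x : ℝ) : Real.exp (-a * x ^ 2 / 2) = Real.exp (-a * (t x - Real.log (t x) - 1)) := by
    rw [ht.sub_log]
    ring_nf
  simp only [e]
  exact ⟨(ht.integrable_comp_iff _).2 h1, (ht.integral_comp _).trans h2⟩

lemma IsZetaInverse.integrable_deriv_mul_gaussian {t : ℝ → ℝ} (ht : IsZetaInverse t) {a : ℝ}
    (ha : 0 < a) : Integrable (fun x => x * t x / (t x - 1) * Real.exp (-a * x ^ 2 / 2)) := by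
  have h := (integrableOn_rpow_mul_exp_neg_mul (b := a) (by linarith) ha).1
  refine ((ht.integrable_comp_iff _).2 h).congr (Filter.Eventually.of_forall fun x => ?_)
  simp only
  rw [← exp_neg_mul_sub_log (ht.pos x), ht.sub_log]
  ring_nf

lemma IsZetaInverse.integrable_gaussian_mul {t : ℝ → ℝ} (ht : IsZetaInverse t) {a : ℝ}
    (ha : 0 < a) {η : ℝ} {h : ℝ → ℝ} (hc : Continuous h)
    (hh : ∀ x, x ≠ 0 → x ≠ η → h x = x * t x / (t x - 1) / (t x - t η) - 1 / (x - η)) :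
    Integrable (fun x => Real.exp (-a * x ^ 2 / 2) * h x) := by
  have hcont : Continuous fun x => Real.exp (-a * x ^ 2 / 2) * h x := by fun_prop
  rw [← integrableOn_univ, ← Set.union_compl_self (Set.Icc (η - 1) (η + 1))]
  refine (hcont.integrableOn_Icc).union ?_
  have hg : Integrable (fun u : ℝ => Real.exp (-a * u ^ 2 / 2)) := by
    convert integrable_exp_neg_mul_sq (half_pos ha) using 3
    ring
  have h1 : t (η - 1) < t η := ht.strictMono (by linarith)
  have h2 : t η < t (η + 1) := ht.strictMono (by linarith)
  set δ := min (t η - t (η - 1)) (t (η + 1) - t η)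
  have hδ : 0 < δ := lt_min (by linarith) (by linarith)
  refine Integrable.mono' (g := fun x => δ⁻¹ * (x * t x / (t x - 1) * Real.exp (-a * x ^ 2 / 2))
    + Real.exp (-a * x ^ 2 / 2)) ?_ hcont.aestronglyMeasurable ?_
  · exact (((ht.integrable_deriv_mul_gaussian ha).const_mul _).add hg).integrableOn
  filter_upwards [ae_restrict_mem measurableSet_Icc.compl,
    ae_restrict_of_ae (Measure.ae_ne volume (0 : ℝ)),
    ae_restrict_of_ae (Measure.ae_ne volume η)] with x hx hx0 hxη
  have hd := ht.deriv_pos hx0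
  have hE := Real.exp_pos (-a * x ^ 2 / 2)
  have hx' : x < η - 1 ∨ η + 1 < x := by
    by_contra! hcon
    exact hx hcon
  have hu : 1 ≤ |x - η| := by
    rcases hx' with h | h
    · rw [abs_of_neg (by linarith)]
      linarith
    · rw [abs_of_pos (by linarith)]
      linarith
  have htx : δ ≤ |t x - t η| := by
    rcases hx' with h | h
    · have := ht.strictMono h
      rw [abs_of_neg (by linarith)]
      exact (min_le_left _ _).trans (by linarith)
    · have := ht.strictMono h
      rw [abs_of_pos (by linarith)]
      exact (min_le_right _ _).trans (by linarith)
  rw [hh x hx0 hxη, norm_mul, Real.norm_of_nonneg hE.le, Real.norm_eq_abs]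
  have b1 : |x * t x / (t x - 1) / (t x - t η)| ≤ x * t x / (t x - 1) * δ⁻¹ := by
    rw [abs_div, abs_of_pos hd, div_eq_mul_inv _ |t x - t η|]
    gcongr
  have b2 : |1 / (x - η)| ≤ 1 := by
    rw [abs_div, abs_one]
    exact div_le_one_of_le₀ hu (abs_nonneg _)
  calc _ ≤ Real.exp (-a * x ^ 2 / 2) * (x * t x / (t x - 1) * δ⁻¹ + 1) := by
        gcongr
        exact (abs_sub _ _).trans (add_le_add b1 b2)
    _ = _ := by ring

lemma tendsto_log_one_add_inv_sq (l : Filter ℝ) (η : ℝ)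
    (hl : Filter.Tendsto (fun x : ℝ => |x|) l Filter.atTop) :
    Filter.Tendsto (fun x : ℝ => Real.log (1 + ((x - η) ^ 2)⁻¹)) l (nhds 0) := by
  have h1 : Filter.Tendsto (fun x : ℝ => |x - η|) l Filter.atTop :=
    Filter.tendsto_atTop_mono (fun x => abs_sub_abs_le_abs_sub x η)
      (Filter.tendsto_atTop_add_const_right l (-|η|) hl)
  have h2 : Filter.Tendsto (fun x : ℝ => ((x - η) ^ 2)⁻¹) l (nhds 0) := by
    have h3 := ((Filter.tendsto_pow_atTop two_ne_zero).comp h1)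
    exact (tendsto_inv_atTop_zero.comp h3).congr fun x => by simp
  have h4 := ((h2.const_add 1).log (by norm_num))
  simpa using h4

lemma IsZetaInverse.hasDerivAt_primitive {t : ℝ → ℝ} (ht : IsZetaInverse t) {η x : ℝ}
    (hx0 : x ≠ 0) (hxη : x ≠ η) :
    HasDerivAt (fun x => Real.log ((Real.sqrt (t x) - Real.sqrt (t η)) /
        (Real.sqrt (t x) + Real.sqrt (t η))) + Real.log (1 + ((x - η) ^ 2)⁻¹) / 2)
      (x * t x / (t x - 1) * ((t x / t η) ^ (-(1 / 2) : ℝ) / (t x - t η))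
        - (1 + (x - η) ^ 2)⁻¹ / (x - η)) x := by
  have h0 := ht.pos x
  have hη := ht.pos η
  have hs := Real.sqrt_pos.2 h0
  have hk := Real.sqrt_pos.2 hη
  have hu : x - η ≠ 0 := sub_ne_zero.2 hxη
  have hne : t x - t η ≠ 0 := sub_ne_zero.2 (ht.strictMono.injective.ne hxη)
  have e2 : t x - t η = (Real.sqrt (t x) - Real.sqrt (t η)) *
      (Real.sqrt (t x) + Real.sqrt (t η)) := by
    nlinarith [Real.sq_sqrt h0.le, Real.sq_sqrt hη.le]
  have hne2 : Real.sqrt (t x) - Real.sqrt (t η) ≠ 0 := fun h => hne (by rw [e2, h, zero_mul])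
  have hsq := (ht.hasDerivAt hx0).sqrt h0.ne'
  have hsum : Real.sqrt (t x) + Real.sqrt (t η) ≠ 0 := by positivity
  have hp : 0 < 1 + ((x - η) ^ 2)⁻¹ := by positivity
  have d1 := ((hsq.sub_const (Real.sqrt (t η))).fun_div (hsq.add_const (Real.sqrt (t η)))
    hsum).log (div_ne_zero hne2 hsum)
  have d2 := (((((((hasDerivAt_id x).sub_const η).fun_pow 2).fun_inv (pow_ne_zero 2 hu)).const_add
    1).log hp.ne').div_const 2)
  refine (d1.add d2).congr_deriv ?_
  have h1 : 1 + (x - η) ^ 2 ≠ 0 := by positivity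
  refine (congrArg₂ (· + ·) ?_ ?_).trans (sub_eq_add_neg _ _).symm
  · rw [Real.rpow_neg (by positivity), ← Real.sqrt_eq_rpow, Real.sqrt_div h0.le, e2]
    generalize x * t x / (t x - 1) = p
    field_simp
    ring
  · simp only [id]
    push_cast
    rw [show 1 + ((x - η) ^ 2)⁻¹ = (1 + (x - η) ^ 2) / (x - η) ^ 2 by field_simp; ring]
    field_simp

lemma IsZetaInverse.integral_primitive {t : ℝ → ℝ} (ht : IsZetaInverse t) {η d : ℝ}
    (hd0 : 0 < d) (hd : HasDerivAt t d η)
    (hi : Integrable fun x => x * t x / (t x - 1) *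
      ((t x / t η) ^ (-(1 / 2) : ℝ) / (t x - t η)) - (1 + (x - η) ^ 2)⁻¹ / (x - η)) :
    ∫ x, (x * t x / (t x - 1) * ((t x / t η) ^ (-(1 / 2) : ℝ) / (t x - t η))
      - (1 + (x - η) ^ 2)⁻¹ / (x - η)) = 0 := by
  set D₀ : ℝ → ℝ := fun x => Real.log ((Real.sqrt (t x) - Real.sqrt (t η)) /
        (Real.sqrt (t x) + Real.sqrt (t η))) + Real.log (1 + ((x - η) ^ 2)⁻¹) / 2 with hD₀
  set D : ℝ → ℝ := fun x => Real.log (dslope t η x) -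
    2 * Real.log (Real.sqrt (t x) + Real.sqrt (t η)) + Real.log (1 + (x - η) ^ 2) / 2 with hD
  have hk : 0 < Real.sqrt (t η) := Real.sqrt_pos.2 (ht.pos η)
  have hsum (x : ℝ) : 0 < Real.sqrt (t x) + Real.sqrt (t η) := by positivity
  have hq (x : ℝ) : 0 < dslope t η x := by
    rcases eq_or_ne x η with rfl | hx
    · rwa [dslope_same, hd.deriv]
    · rw [dslope_of_ne _ hx, slope_def_field]
      rcases hx.lt_or_gt with h | h
      · exact div_pos_of_neg_of_neg (sub_neg.2 (ht.strictMono h)) (sub_neg.2 h)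
      · exact div_pos (sub_pos.2 (ht.strictMono h)) (sub_pos.2 h)
  have hqc : Continuous (dslope t η) := by
    refine continuous_iff_continuousAt.2 fun x => ?_
    rcases eq_or_ne x η with rfl | hx
    · exact continuousAt_dslope_same.2 hd.differentiableAt
    · exact (continuousAt_dslope_of_ne hx).2 ht.continuous.continuousAt
  have hDc : Continuous D := by
    have h1 := hqc.log fun x => (hq x).ne'
    have h2 : Continuous fun x => Real.log (Real.sqrt (t x) + Real.sqrt (t η)) :=
      (ht.continuous.sqrt.add continuous_const).log fun x => (hsum x).ne'
    have h3 : Continuous fun x : ℝ => Real.log (1 + (x - η) ^ 2) :=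
      Continuous.log (by fun_prop) fun x => by positivity
    exact (h1.sub (h2.const_mul 2)).add (h3.div_const 2)
  have hDD (x : ℝ) (hx : x ≠ η) : D x = D₀ x := by
    have hu : x - η ≠ 0 := sub_ne_zero.2 hx
    have hne : t x - t η ≠ 0 := sub_ne_zero.2 (ht.strictMono.injective.ne hx)
    have e2 : t x - t η = (Real.sqrt (t x) - Real.sqrt (t η)) *
        (Real.sqrt (t x) + Real.sqrt (t η)) := by
      nlinarith [Real.sq_sqrt (ht.pos x).le, Real.sq_sqrt (ht.pos η).le]
    have hne2 : Real.sqrt (t x) - Real.sqrt (t η) ≠ 0 := fun h => hne (by rw [e2, h, zero_mul])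
    simp only [hD, hD₀]
    rw [dslope_of_ne _ hx, slope_def_field, e2, Real.log_div (mul_ne_zero hne2 (hsum x).ne') hu,
      Real.log_mul hne2 (hsum x).ne', Real.log_div hne2 (hsum x).ne',
      show 1 + ((x - η) ^ 2)⁻¹ = (1 + (x - η) ^ 2) / (x - η) ^ 2 by field_simp; ring,
      Real.log_div (by positivity) (pow_ne_zero 2 hu), Real.log_pow]
    push_cast
    ring
  have hDtop : Filter.Tendsto D Filter.atTop (nhds 0) := by
    have h1 : Filter.Tendsto (fun x => Real.sqrt (t x) + Real.sqrt (t η)) Filter.atTop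
        Filter.atTop :=
      Filter.tendsto_atTop_add_const_right _ _ (Real.tendsto_sqrt_atTop.comp ht.tendsto_atTop)
    have h2 := ((h1.inv_tendsto_atTop.const_mul (2 * Real.sqrt (t η))).const_sub 1).log (by simp)
    have h3 := h2.add ((tendsto_log_one_add_inv_sq _ η Filter.tendsto_abs_atTop_atTop).div_const 2)
    simp only [mul_zero, sub_zero, Real.log_one, zero_div, add_zero] at h3
    refine h3.congr' ?_
    filter_upwards [Filter.eventually_ne_atTop η] with x hx
    rw [hDD x hx]
    simp only [hD₀, Pi.inv_apply]
    congr 2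
    have := (hsum x).ne'
    field_simp
    ring
  have hDbot : Filter.Tendsto D Filter.atBot (nhds 0) := by
    have h1 : Filter.Tendsto (fun x => Real.sqrt (t x)) Filter.atBot (nhds 0) := by
      simpa using ht.tendsto_atBot.sqrt
    have h2 := ((h1.sub_const (Real.sqrt (t η))).div (h1.add_const (Real.sqrt (t η)))
      (by simpa using hk.ne')).log (by simpa using hk.ne')
    have h3 := h2.add ((tendsto_log_one_add_inv_sq _ η Filter.tendsto_abs_atBot_atTop).div_const 2)
    rw [zero_sub, zero_add, neg_div, div_self hk.ne', Real.log_neg_eq_log, Real.log_one, zero_div,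
      add_zero] at h3
    refine h3.congr' ?_
    filter_upwards [Filter.eventually_ne_atBot η] with x hx
    exact (hDD x hx).symm
  have hderiv (x : ℝ) (hx0 : x ≠ 0) (hx : x ≠ η) : HasDerivAt D (x * t x / (t x - 1) *
      ((t x / t η) ^ (-(1 / 2) : ℝ) / (t x - t η)) - (1 + (x - η) ^ 2)⁻¹ / (x - η)) x := by
    refine (ht.hasDerivAt_primitive hx0 hx).congr_of_eventuallyEq ?_
    filter_upwards [isOpen_ne.mem_nhds hx] with y hy using hDD y hy
  have hlim := intervalIntegral_tendsto_integral hi Filter.tendsto_neg_atTop_atBot Filter.tendsto_id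
  have hlim2 : Filter.Tendsto (fun r : ℝ => D r - D (-r)) Filter.atTop (nhds (0 - 0)) :=
    hDtop.sub (hDbot.comp Filter.tendsto_neg_atTop_atBot)
  rw [sub_zero] at hlim2
  refine tendsto_nhds_unique hlim (hlim2.congr fun r => ?_)
  refine (integral_eq_of_hasDerivAt_off_countable D _ (s := {0, η})
    (Set.toFinite _).countable hDc.continuousOn (fun x hx => ?_) hi.intervalIntegrable).symm
  have hx2 := hx.2
  simp only [Set.mem_insert_iff, Set.mem_singleton_iff, not_or] at hx2
  exact hderiv x hx2.1 hx2.2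

lemma IsZetaInverse.exists_hasDerivAt {t : ℝ → ℝ} (ht : IsZetaInverse t) {η : ℝ} {g : ℝ → ℝ}
    (hgc : Continuous g) (hgη : g η = 1)
    (hg : ∀ x : ℝ, x ≠ 0 → x ≠ η → g x = x * t x * (x - η) / ((t x - 1) * (t x - t η))) :
    ∃ d, 0 < d ∧ HasDerivAt t d η := by
  rcases eq_or_ne η 0 with rfl | hη
  · refine ⟨1, one_pos, hasDerivAt_iff_tendsto_slope.2 ?_⟩
    have h1 : Filter.Tendsto (fun x => Real.sqrt (t x / g x)) (nhdsWithin 0 {0}ᶜ) (nhds 1) := by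
      have h2 := (ht.continuous.continuousAt.tendsto.div (hgc.tendsto 0) (by simp [hgη])).sqrt
      rw [hgη, ht.map_zero, div_one, Real.sqrt_one] at h2
      exact h2.mono_left nhdsWithin_le_nhds
    refine h1.congr' ?_
    filter_upwards [self_mem_nhdsWithin] with x hx
    have hx0 : x ≠ 0 := hx
    have h3 : t x - 1 ≠ 0 := sub_ne_zero.2 (ht.ne_one hx0)
    have h4 : 0 < (t x - 1) / x := by
      rcases hx0.lt_or_gt with h | h
      · exact div_pos_of_neg_of_neg (sub_neg.2 (ht.lt_one x h)) h
      · exact div_pos (sub_pos.2 (ht.one_lt x h)) h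
    rw [slope_def_field, ht.map_zero, sub_zero, hg x hx0 hx0, ht.map_zero, sub_zero,
      show t x / (x * t x * x / ((t x - 1) * (t x - 1))) = ((t x - 1) / x) ^ 2 by
        have := (ht.pos x).ne'
        field_simp,
      Real.sqrt_sq h4.le]
  · exact ⟨_, ht.deriv_pos hη, ht.hasDerivAt hη⟩

lemma IsZetaInverse.integral_gaussian_mul {t : ℝ → ℝ} (ht : IsZetaInverse t) {a : ℝ} (ha : 0 < a)
    {η d : ℝ} (hd0 : 0 < d) (hd : HasDerivAt t d η) {h : ℝ → ℝ} (hc : Continuous h)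
    (hh : ∀ x, x ≠ 0 → x ≠ η → h x = x * t x / (t x - 1) / (t x - t η) - 1 / (x - η)) :
    ∫ x, Real.exp (-a * x ^ 2 / 2) * h x = Real.exp (-a * η ^ 2 / 2) *
      ((∫ v in Set.Ioi (0 : ℝ),
        (v ^ a * Real.exp (-(a * t η) * (v - 1)) - v ^ (-(1 / 2) : ℝ)) / (v - 1))
      + a * Real.sqrt (2 * Real.pi / a) * ∫ y in (0 : ℝ)..η, Real.exp (a * y ^ 2 / 2)) := by
  obtain ⟨a1, a2⟩ := ht.integral_pv ha η
  obtain ⟨b1, b2⟩ := integral_gaussian_mul_exp_sub_one_div ha η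
  have o1 := integrable_gaussian_sub_inv_div ha
  have o2 := integral_gaussian_sub_inv_div a
  have w1 := ht.integrable_gaussian_mul ha hc hh
  have b1' := b1.comp_sub_right η
  have o1' := o1.comp_sub_right η
  rw [← integral_sub_right_eq_self _ η] at b2 o2
  have hcpos := Real.exp_pos (-a * η ^ 2 / 2)
  have key (x : ℝ) (hx0 : x ≠ 0) (hx : x ≠ η) :
      x * t x / (t x - 1) * ((t x / t η) ^ (-(1 / 2) : ℝ) / (t x - t η))
        - (1 + (x - η) ^ 2)⁻¹ / (x - η)
      = (Real.exp (-a * η ^ 2 / 2))⁻¹ * (Real.exp (-a * x ^ 2 / 2) * h x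
        - x * t x / (t x - 1) * ((Real.exp (-a * x ^ 2 / 2)
          - Real.exp (-a * η ^ 2 / 2) * (t x / t η) ^ (-(1 / 2) : ℝ)) / (t x - t η)))
        + Real.exp (-a * (x - η) ^ 2 / 2) * (Real.exp (-η * (a * (x - η))) - 1) / (x - η)
        + (Real.exp (-a * (x - η) ^ 2 / 2) - (1 + (x - η) ^ 2)⁻¹) / (x - η) := by
    have e : Real.exp (-a * (x - η) ^ 2 / 2) * Real.exp (-η * (a * (x - η)))
        = (Real.exp (-a * η ^ 2 / 2))⁻¹ * Real.exp (-a * x ^ 2 / 2) := by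
      rw [← Real.exp_neg, ← Real.exp_add, ← Real.exp_add]
      congr 1
      ring
    have hu : x - η ≠ 0 := sub_ne_zero.2 hx
    have hne : t x - t η ≠ 0 := sub_ne_zero.2 (ht.strictMono.injective.ne hx)
    rw [hh x hx0 hx, mul_sub (Real.exp (-a * (x - η) ^ 2 / 2)), e]
    generalize x * t x / (t x - 1) = p
    generalize (1 + (x - η) ^ 2)⁻¹ = r
    generalize (t x / t η) ^ (-(1 / 2) : ℝ) = k
    generalize Real.exp (-a * (x - η) ^ 2 / 2) = m
    field_simp
    ring
  have hae := ((Measure.ae_ne volume (0 : ℝ)).and (Measure.ae_ne volume η)).mono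
    fun x hx => key x hx.1 hx.2
  have i0 := w1.sub a1
  simp only [Pi.sub_def] at i0
  have i1 := i0.const_mul (Real.exp (-a * η ^ 2 / 2))⁻¹
  have hC := ht.integral_primitive hd0 hd (((i1.fun_add b1').fun_add o1').congr
    (hae.mono fun _ h => h.symm))
  rw [integral_congr_ae hae, integral_add (i1.fun_add b1') o1', integral_add i1 b1', b2, o2,
    integral_const_mul, integral_sub w1 a1, a2] at hC
  field_simp at hC ⊢
  linarith

/-- Real uniform error-function representation for `γ*(-a,-z)`:
with `λ = z/a`, `η = ζ(λ)` where `ζ(t) = sign(t-1)√(2(t - ln t - 1))` with inverse `t(·)`,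
`g(ζ) = ζ t(ζ)(ζ-η)/((t(ζ)-1)(t(ζ)-λ))` extended continuously (`g(η)=1`),
`h(ζ) = (g(ζ)-1)/(ζ-η)` extended continuously at `η`, and
`T_a(η) = -√(a/(2π)) ∫_{-∞}^{∞} e^(-aζ²/2) h(ζ) dζ` (absolutely convergent), one has
`γ*(-a,-z) = z^a { cos(πa) - √(2a/π) e^(aη²/2) sin(πa)[√(2/a) F(η√(a/2)) + T_a(η)/a] }`. -/
theorem gammaStar_neg_real_expansion (a z : ℝ) (ha : 0 < a) (hz : 0 < z)
    (zeta : ℝ → ℝ)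
    (hzeta : ∀ s : ℝ, zeta s = Real.sign (s - 1) * Real.sqrt (2 * (s - Real.log s - 1)))
    (tinv : ℝ → ℝ) (htinv_pos : ∀ x : ℝ, 0 < tinv x)
    (htinv_left : ∀ s : ℝ, 0 < s → tinv (zeta s) = s)
    (htinv_right : ∀ x : ℝ, zeta (tinv x) = x)
    (lam : ℝ) (hlam : lam = z / a) (η : ℝ) (hη : η = zeta lam)
    (g : ℝ → ℝ) (hg_cont : Continuous g)
    (hg : ∀ x : ℝ, x ≠ 0 → x ≠ η →
      g x = x * tinv x * (x - η) / ((tinv x - 1) * (tinv x - lam)))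
    (hgη : g η = 1)
    (h : ℝ → ℝ) (hh_cont : Continuous h)
    (hh : ∀ x : ℝ, x ≠ η → h x = (g x - 1) / (x - η)) :
    Integrable (fun x : ℝ => Real.exp (-a * x ^ 2 / 2) * h x) ∧
    gammaStar (-(a : ℂ)) (-(z : ℂ)) =
      ((z ^ a * (Real.cos (Real.pi * a) -
        Real.sqrt (2 * a / Real.pi) * Real.exp (a * η ^ 2 / 2) * Real.sin (Real.pi * a) *
          (Real.sqrt (2 / a) * dawson (η * Real.sqrt (a / 2)) +
            (1 / a) * (-Real.sqrt (a / (2 * Real.pi)) *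
              ∫ x : ℝ, Real.exp (-a * x ^ 2 / 2) * h x))) : ℝ) : ℂ) := by
  have ht := IsZetaInverse.of_inverse hzeta htinv_pos htinv_left htinv_right
  have hlam0 : 0 < lam := by
    rw [hlam]
    positivity
  have htη : tinv η = lam := by rw [hη, htinv_left lam hlam0]
  have hzl : a * tinv η = z := by
    rw [htη, hlam]
    field_simp
  rw [← htη] at hg
  obtain ⟨d, hd0, hd⟩ := ht.exists_hasDerivAt hg_cont hgη hg
  have hh' (x : ℝ) (hx0 : x ≠ 0) (hx : x ≠ η) :
      h x = x * tinv x / (tinv x - 1) / (tinv x - tinv η) - 1 / (x - η) := by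
    have hu : x - η ≠ 0 := sub_ne_zero.2 hx
    rw [hh x hx, hg x hx0 hx, sub_div]
    congr 1
    field_simp
  refine ⟨ht.integrable_gaussian_mul ha hh_cont hh', ?_⟩
  have hpv := (pvEvaluation ha hz).2.2
  rw [gammaStar_neg_ofReal, ht.integral_gaussian_mul ha hd0 hd hh_cont hh', dawson_mul_sqrt ha, hzl]
  congr 1
  generalize Real.exp z * ∑' n : ℕ, (-z) ^ n / Real.Gamma (-a + n + 1) = S at hpv ⊢
  generalize (∫ v in Set.Ioi (0 : ℝ),
    (v ^ a * Real.exp (-z * (v - 1)) - v ^ (-(1 / 2) : ℝ)) / (v - 1)) = n at hpv ⊢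
  generalize (∫ y in (0 : ℝ)..η, Real.exp (a * y ^ 2 / 2)) = J
  have hπ := Real.pi_pos
  have e1 : Real.sqrt (2 / a) * Real.sqrt (a / 2) = 1 := by
    rw [← Real.sqrt_mul (by positivity), show 2 / a * (a / 2) = 1 by field_simp, Real.sqrt_one]
  have e2 : Real.sqrt (a / (2 * Real.pi)) * Real.sqrt (2 * Real.pi / a) = 1 := by
    rw [← Real.sqrt_mul (by positivity),
      show a / (2 * Real.pi) * (2 * Real.pi / a) = 1 by field_simp, Real.sqrt_one]
  have e3 : Real.sqrt (2 * a / Real.pi) * Real.sqrt (a / (2 * Real.pi)) = a / Real.pi := by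
    rw [← Real.sqrt_mul (by positivity),
      show 2 * a / Real.pi * (a / (2 * Real.pi)) = (a / Real.pi) ^ 2 by field_simp,
      Real.sqrt_sq (by positivity)]
  have e4 : Real.exp (a * η ^ 2 / 2) * Real.exp (-a * η ^ 2 / 2) = 1 := by
    rw [← Real.exp_add, show a * η ^ 2 / 2 + -a * η ^ 2 / 2 = 0 by ring, Real.exp_zero]
  have e5 : z ^ a * z ^ (-a) = 1 := by
    rw [← Real.rpow_add hz, add_neg_cancel, Real.rpow_zero]
  have hbr : Real.sqrt (2 / a) * (Real.exp (-a * η ^ 2 / 2) * (Real.sqrt (a / 2) * J)) +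
      1 / a * (-Real.sqrt (a / (2 * Real.pi)) * (Real.exp (-a * η ^ 2 / 2) *
        (n + a * Real.sqrt (2 * Real.pi / a) * J)))
      = -(1 / a) * Real.sqrt (a / (2 * Real.pi)) * Real.exp (-a * η ^ 2 / 2) * n := by
    have e6 : 1 / a * a = 1 := by field_simp
    linear_combination Real.exp (-a * η ^ 2 / 2) * J * e1
      - Real.exp (-a * η ^ 2 / 2) * J * (1 / a * a) * e2 - Real.exp (-a * η ^ 2 / 2) * J * e6
  have hmain : Real.sqrt (2 * a / Real.pi) * Real.exp (a * η ^ 2 / 2) * Real.sin (Real.pi * a) *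
      (-(1 / a) * Real.sqrt (a / (2 * Real.pi)) * Real.exp (-a * η ^ 2 / 2) * n)
      = -(1 / Real.pi * (Real.sin (Real.pi * a) * n)) := by
    calc _ = -(1 / a) * (Real.sqrt (2 * a / Real.pi) * Real.sqrt (a / (2 * Real.pi))) *
          (Real.exp (a * η ^ 2 / 2) * Real.exp (-a * η ^ 2 / 2)) * (Real.sin (Real.pi * a) * n) := by
          ring
      _ = _ := by
          rw [e3, e4]
          field_simp
  rw [hbr, hmain, hpv]
  have e7 : 1 / Real.pi * (Real.pi * (z ^ (-a) * S - Real.cos (Real.pi * a)))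
      = z ^ (-a) * S - Real.cos (Real.pi * a) := by
    field_simp
  rw [e7]
  linear_combination -S * e5
end

section
/- Fix real a > 0. Let ζ : (0,∞) → ℝ, ζ(t) = sign(t−1)·√(2(t − ln t − 1)), a strictly increasing bijection with inverse t(·) : ℝ → (0,∞). For each η ∈ ℝ put λ = t(η), define g_η : ℝ → ℝ by g_η(ζ) = ζ · t(ζ) · (ζ − η) / ((t(ζ) − 1)(t(ζ) − λ)) for ζ ∉ {0, η}, extended continuously (g_η(η) = 1), h_η(ζ) = (g_η(ζ) − 1)/(ζ − η) extended continuously at ζ = η, and T_a(η) = −√(a/(2π)) ∫_{−∞}^{∞} e^(−aζ²/2) h_η(ζ) dζ. Then the function η ↦ T_a(η) is differentiable on ℝ and satisfies the differential equation T_a′(η) + a·η·T_a(η) = a·( f(η)·Γ*(a) − 1 ), where f(η) = η/(λ − 1) for η ≠ 0 (extended by f(0) = 1) and Γ*(a) = √(a/(2π)) · e^a · a^(−a) · Γ(a). -/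
open MeasureTheory

/-- A strictly increasing function from `ℝ` onto the positive reals is continuous. -/
lemma continuous_of_strictMono_of_surj_pos {t : ℝ → ℝ} (hpos : ∀ x, 0 < t x)
    (hmono : StrictMono t) (hsurj : ∀ s, 0 < s → ∃ x, t x = s) : Continuous t := by
  have hl : Continuous fun x => Real.log (t x) := by
    refine Monotone.continuous_of_surjective
      (fun x y hxy => Real.log_le_log (hpos x) (hmono.monotone hxy)) fun w => ?_
    obtain ⟨x, hx⟩ := hsurj (Real.exp w) (Real.exp_pos w)
    exact ⟨x, by simp [hx]⟩
  refine (Real.continuous_exp.comp hl).congr fun x => ?_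
  simp [Real.exp_log (hpos x)]

/-- `t` is the inverse of `s ↦ sign (s - 1) * √(2 * (s - log s - 1))` and `f` is its logarithmic
derivative, given by `f x = x / (t x - 1)` away from the origin. -/
structure IsZetaInverse_s13 (t f : ℝ → ℝ) : Prop where
  pos : ∀ x, 0 < t x
  sq : ∀ x, x ^ 2 = 2 * (t x - Real.log (t x) - 1)
  strictMono : StrictMono t
  surj : ∀ s, 0 < s → ∃ x, t x = s
  f_mul : ∀ x, f x * (t x - 1) = x
  f_zero : f 0 = 1
  f_continuousAt : ContinuousAt f 0

namespace IsZetaInverse_s13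

variable {t f : ℝ → ℝ}

lemma t_zero (H : IsZetaInverse_s13 t f) : t 0 = 1 := by
  have := H.f_mul 0
  rw [H.f_zero] at this
  linarith

lemma sub_one_ne (H : IsZetaInverse_s13 t f) {x : ℝ} (hx : x ≠ 0) : t x - 1 ≠ 0 := by
  intro h
  have := H.f_mul x
  rw [h, mul_zero] at this
  exact hx this.symm

lemma one_lt (H : IsZetaInverse_s13 t f) {x : ℝ} (hx : 0 < x) : 1 < t x :=
  H.t_zero ▸ H.strictMono hx

lemma lt_one (H : IsZetaInverse_s13 t f) {x : ℝ} (hx : x < 0) : t x < 1 :=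
  H.t_zero ▸ H.strictMono hx

lemma f_eq_div (H : IsZetaInverse_s13 t f) {x : ℝ} (hx : x ≠ 0) : f x = x / (t x - 1) := by
  rw [eq_div_iff (H.sub_one_ne hx), H.f_mul]

lemma f_pos (H : IsZetaInverse_s13 t f) (x : ℝ) : 0 < f x := by
  rcases lt_trichotomy x 0 with hx | rfl | hx
  · rw [H.f_eq_div hx.ne]
    exact div_pos_of_neg_of_neg hx (by linarith [H.lt_one hx])
  · rw [H.f_zero]; exact one_pos
  · rw [H.f_eq_div hx.ne']
    exact div_pos hx (by linarith [H.one_lt hx])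

lemma continuous_s13 (H : IsZetaInverse_s13 t f) : Continuous t :=
  continuous_of_strictMono_of_surj_pos H.pos H.strictMono H.surj

lemma f_continuous (H : IsZetaInverse_s13 t f) : Continuous f := by
  refine continuous_iff_continuousAt.2 fun x => ?_
  rcases eq_or_ne x 0 with rfl | hx
  · exact H.f_continuousAt
  · have : ContinuousAt (fun y => y / (t y - 1)) x :=
      continuousAt_id.div (H.continuous_s13.continuousAt.sub continuousAt_const) (H.sub_one_ne hx)
    refine this.congr ?_
    filter_upwards [isOpen_ne.mem_nhds hx] with y hy using (H.f_eq_div hy).symm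

lemma hasDerivAt_of_ne (H : IsZetaInverse_s13 t f) {x : ℝ} (hx : x ≠ 0) :
    HasDerivAt t (t x * f x) x := by
  set σ : ℝ := x / |x| with hσ
  have habs : |x| ≠ 0 := abs_ne_zero.2 hx
  have hpos := H.pos x
  have hne := H.sub_one_ne hx
  have hφ : HasDerivAt (fun s => σ * Real.sqrt (2 * (s - Real.log s - 1)))
      ((t x - 1) / (t x * x)) (t x) := by
    have h1 : HasDerivAt (fun s => 2 * (s - Real.log s - 1)) (2 * (1 - (t x)⁻¹)) (t x) :=
      (((hasDerivAt_id _).sub (Real.hasDerivAt_log hpos.ne')).sub_const 1).const_mul 2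
    have h2 := (h1.sqrt (by rw [← H.sq x]; positivity)).const_mul σ
    rw [← H.sq x, Real.sqrt_sq_eq_abs] at h2
    refine h2.congr_deriv ?_
    rw [hσ]
    have hx2 : |x| * |x| = x * x := abs_mul_abs_self x
    field_simp
    rw [pow_two, pow_two, hx2]
  have key := HasDerivAt.of_local_left_inverse (g := t) H.continuous_s13.continuousAt hφ
    (div_ne_zero hne (mul_ne_zero hpos.ne' hx)) (by
      rcases lt_or_gt_of_ne hx with h | h
      · filter_upwards [Iio_mem_nhds h] with y hy
        have hy' : y < 0 := hy
        rw [← H.sq y, Real.sqrt_sq_eq_abs, hσ, abs_of_neg h, abs_of_neg hy']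
        field_simp
      · filter_upwards [Ioi_mem_nhds h] with y hy
        have hy' : 0 < y := hy
        rw [← H.sq y, Real.sqrt_sq_eq_abs, hσ, abs_of_pos h, abs_of_pos hy']
        field_simp)
  refine key.congr_deriv ?_
  rw [H.f_eq_div hx, inv_div]
  ring

lemma hasDerivAt_s13 (H : IsZetaInverse_s13 t f) (x : ℝ) : HasDerivAt t (t x * f x) x := by
  rcases eq_or_ne x 0 with rfl | hx
  · exact hasDerivAt_of_hasDerivAt_of_ne (g := fun y => t y * f y)
      (fun y hy => H.hasDerivAt_of_ne hy) H.continuous_s13.continuousAt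
      (H.continuous_s13.mul H.f_continuous).continuousAt
  · exact H.hasDerivAt_of_ne hx

lemma hasDerivAt_log (H : IsZetaInverse_s13 t f) (x : ℝ) :
    HasDerivAt (fun y => Real.log (t y)) (f x) x := by
  refine ((H.hasDerivAt_s13 x).log (H.pos x).ne').congr_deriv ?_
  field_simp [(H.pos x).ne']

lemma hasDerivAt_f (H : IsZetaInverse_s13 t f) {x : ℝ} (hx : x ≠ 0) :
    HasDerivAt f ((1 - t x * f x ^ 2) / (t x - 1)) x := by
  have hne := H.sub_one_ne hx
  have h := (hasDerivAt_id x).div ((H.hasDerivAt_s13 x).sub_const 1) hne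
  have h' : HasDerivAt (fun y => y / (t y - 1)) ((1 - t x * f x ^ 2) / (t x - 1)) x := by
    refine h.congr_deriv ?_
    have := H.f_mul x
    rw [div_eq_div_iff (pow_ne_zero 2 hne) hne, id]
    linear_combination t x * f x * (t x - 1) * this
  refine h'.congr_of_eventuallyEq ?_
  filter_upwards [isOpen_ne.mem_nhds hx] with y hy using H.f_eq_div hy

lemma t_mul_f_sq (H : IsZetaInverse_s13 t f) (x : ℝ) :
    t x * f x ^ 2 * (t x - 1) ^ 2 = 2 * t x * (t x - Real.log (t x) - 1) := by
  linear_combination t x * (H.sq x) + t x * (f x * (t x - 1) + x) * H.f_mul x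

lemma deriv_f_nonpos (H : IsZetaInverse_s13 t f) {x : ℝ} (hx : x ≠ 0) :
    (1 - t x * f x ^ 2) / (t x - 1) ≤ 0 := by
  have hpos := H.pos x
  have hinv : t x * (t x)⁻¹ = 1 := mul_inv_cancel₀ hpos.ne'
  have key := H.t_mul_f_sq x
  have hsq : 0 < (t x - 1) ^ 2 := by have := H.sub_one_ne hx; positivity
  rcases lt_or_gt_of_ne hx with h | h
  · have ht := H.lt_one h
    refine div_nonpos_of_nonneg_of_nonpos ?_ (by linarith)
    have hl : Real.sinh (Real.log (t x)) ≤ Real.log (t x) :=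
      Real.sinh_le_self_iff.2 (Real.log_nonpos hpos.le ht.le)
    rw [Real.sinh_log hpos] at hl
    have := mul_le_mul_of_nonneg_left hl hpos.le
    have h3 : t x * f x ^ 2 * (t x - 1) ^ 2 ≤ 1 * (t x - 1) ^ 2 := by nlinarith
    linarith [le_of_mul_le_mul_right h3 hsq]
  · have ht := H.one_lt h
    refine div_nonpos_of_nonpos_of_nonneg ?_ (by linarith)
    have hl : Real.log (t x) ≤ Real.sinh (Real.log (t x)) :=
      Real.self_le_sinh_iff.2 (Real.log_nonneg ht.le)
    rw [Real.sinh_log hpos] at hl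
    have := mul_le_mul_of_nonneg_left hl hpos.le
    have h3 : 1 * (t x - 1) ^ 2 ≤ t x * f x ^ 2 * (t x - 1) ^ 2 := by nlinarith
    linarith [le_of_mul_le_mul_right h3 hsq]

end IsZetaInverse_s13

/-- A continuous function on `ℝ` with nonnegative derivative off the origin is monotone. -/
lemma monotone_of_hasDerivAt_nonneg_of_ne_zero {F F' : ℝ → ℝ} (hF : Continuous F)
    (hd : ∀ x, x ≠ 0 → HasDerivAt F (F' x) x) (hn : ∀ x, x ≠ 0 → 0 ≤ F' x) : Monotone F := by
  refine MonotoneOn.Iic_union_Ici (a := 0) ?_ ?_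
  · refine monotoneOn_of_deriv_nonneg (convex_Iic 0) hF.continuousOn ?_ ?_ <;>
      rw [interior_Iic] <;> intro x hx
    · exact (hd x (ne_of_lt hx)).differentiableAt.differentiableWithinAt
    · rw [(hd x (ne_of_lt hx)).deriv]; exact hn x (ne_of_lt hx)
  · refine monotoneOn_of_deriv_nonneg (convex_Ici 0) hF.continuousOn ?_ ?_ <;>
      rw [interior_Ici] <;> intro x hx
    · exact (hd x (ne_of_gt hx)).differentiableAt.differentiableWithinAt
    · rw [(hd x (ne_of_gt hx)).deriv]; exact hn x (ne_of_gt hx)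

/-- The tangent line inequality for a function with monotone derivative. -/
lemma add_mul_sub_le_of_hasDerivAt_monotone {F F' : ℝ → ℝ} (hd : ∀ x, HasDerivAt F (F' x) x)
    (hm : Monotone F') (x y : ℝ) : F x + F' x * (y - x) ≤ F y := by
  have hc : Continuous F := continuous_iff_continuousAt.2 fun z => (hd z).continuousAt
  rcases lt_trichotomy x y with h | rfl | h
  · obtain ⟨c, hcm, hce⟩ := exists_hasDerivAt_eq_slope F F' h hc.continuousOn fun z _ => hd z
    rw [eq_div_iff (by linarith)] at hce
    nlinarith [mul_le_mul_of_nonneg_right (hm hcm.1.le) (sub_pos.2 h).le]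
  · simp
  · obtain ⟨c, hcm, hce⟩ := exists_hasDerivAt_eq_slope F F' h hc.continuousOn fun z _ => hd z
    rw [eq_div_iff (by linarith)] at hce
    nlinarith [mul_le_mul_of_nonneg_right (hm hcm.2.le) (sub_pos.2 h).le]

namespace IsZetaInverse_s13

variable {t f : ℝ → ℝ}

lemma f_antitone (H : IsZetaInverse_s13 t f) : Antitone f := by
  have h : Monotone fun x => -f x :=
    monotone_of_hasDerivAt_nonneg_of_ne_zero H.f_continuous.neg
      (fun x hx => (H.hasDerivAt_f hx).neg) fun x hx => neg_nonneg.2 (H.deriv_f_nonpos hx)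
  exact fun x y hxy => neg_le_neg_iff.1 (h hxy)

lemma deriv_monotone (H : IsZetaInverse_s13 t f) : Monotone fun x => t x * f x := by
  refine monotone_of_hasDerivAt_nonneg_of_ne_zero (H.continuous_s13.mul H.f_continuous)
    (fun x hx => (H.hasDerivAt_s13 x).mul (H.hasDerivAt_f hx)) fun x hx => ?_
  have hne := H.sub_one_ne hx
  have hpos := H.pos x
  have hf := H.f_pos x
  have e : t x * f x * f x + t x * ((1 - t x * f x ^ 2) / (t x - 1))
      = t x * ((1 - f x ^ 2) / (t x - 1)) := by
    field_simp
    ring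
  rw [e]
  refine mul_nonneg hpos.le ?_
  rcases lt_or_gt_of_ne hx with h | h
  · have h1 : 1 ≤ f x := H.f_zero ▸ H.f_antitone h.le
    exact div_nonneg_of_nonpos (by nlinarith) (by linarith [H.lt_one h])
  · have h1 : f x ≤ 1 := H.f_zero ▸ H.f_antitone h.le
    exact div_nonneg (by nlinarith) (by linarith [H.one_lt h])

lemma tangent_le (H : IsZetaInverse_s13 t f) (x y : ℝ) : t x + t x * f x * (y - x) ≤ t y :=
  add_mul_sub_le_of_hasDerivAt_monotone H.hasDerivAt_s13 H.deriv_monotone x y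

lemma log_le_tangent (H : IsZetaInverse_s13 t f) (x y : ℝ) :
    Real.log (t y) ≤ Real.log (t x) + f x * (y - x) := by
  have := add_mul_sub_le_of_hasDerivAt_monotone (fun x => (H.hasDerivAt_log x).neg)
    (fun x y hxy => neg_le_neg (H.f_antitone hxy)) x y
  simp only [Pi.neg_apply] at this
  linarith

lemma abs_log_le (H : IsZetaInverse_s13 t f) (x : ℝ) : |Real.log (t x)| ≤ 1 + x ^ 2 / 2 := by
  have hs := H.sq x
  have he := Real.exp_log (H.pos x)
  rw [abs_le]
  constructor
  · linarith [H.pos x]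
  · rcases le_total 0 (Real.log (t x)) with h | h
    · have := Real.quadratic_le_exp_of_nonneg h
      nlinarith [sq_nonneg (Real.log (t x) - 1)]
    · nlinarith [sq_nonneg x]

lemma f_le (H : IsZetaInverse_s13 t f) (x : ℝ) : f x ≤ 3 + 3 / 2 * x ^ 2 := by
  have h1 := H.log_le_tangent x (x - 1)
  have h2 := (abs_le.1 (H.abs_log_le x)).2
  have h3 := (abs_le.1 (H.abs_log_le (x - 1))).1
  nlinarith [sq_nonneg (x + 1)]

lemma diff_quot_bounds (H : IsZetaInverse_s13 t f) {η x : ℝ} (hx : x ≠ η) :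
    0 ≤ t x * f x / (t x - t η) - 1 / (x - η) ∧
      t x * f x / (t x - t η) - 1 / (x - η) ≤ f x := by
  have h1 : x - η ≠ 0 := sub_ne_zero.2 hx
  have h2 : t x - t η ≠ 0 := sub_ne_zero.2 (H.strictMono.injective.ne hx)
  have hprod : 0 < (x - η) * (t x - t η) := by
    rcases lt_or_gt_of_ne hx with h | h
    · exact mul_pos_of_neg_of_neg (by linarith) (by linarith [H.strictMono h])
    · exact mul_pos (by linarith) (by linarith [H.strictMono h])
  have e : t x * f x / (t x - t η) - 1 / (x - η)
      = (t x * f x * (x - η) - (t x - t η)) / ((x - η) * (t x - t η)) := by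
    field_simp
  rw [e, div_le_iff₀ hprod]
  have ht := H.tangent_le x η
  refine ⟨div_nonneg (by linarith) hprod.le, ?_⟩
  have hl := H.log_le_tangent x η
  have hr := Real.one_sub_inv_le_log_of_pos (div_pos (H.pos η) (H.pos x))
  rw [Real.log_div (H.pos η).ne' (H.pos x).ne', inv_div] at hr
  have h3 : 1 - t x / t η ≤ f x * (η - x) := by linarith
  have h4 := mul_le_mul_of_nonneg_left h3 (H.pos η).le
  have h5 : t η * (1 - t x / t η) = t η - t x := by
    have := (H.pos η).ne'
    field_simp
  rw [h5] at h4
  nlinarith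

lemma dslope_pos (H : IsZetaInverse_s13 t f) (η x : ℝ) : 0 < dslope t η x := by
  rcases eq_or_ne x η with rfl | hx
  · rw [dslope_same, (H.hasDerivAt_s13 x).deriv]
    exact mul_pos (H.pos x) (H.f_pos x)
  · rw [dslope_of_ne _ hx, slope_def_field]
    rcases lt_or_gt_of_ne hx with h | h
    · exact div_pos_of_neg_of_neg (by linarith [H.strictMono h]) (by linarith)
    · exact div_pos (by linarith [H.strictMono h]) (by linarith)

lemma continuous_dslope (H : IsZetaInverse_s13 t f) (η : ℝ) : Continuous (dslope t η) := by
  refine continuous_iff_continuousAt.2 fun x => ?_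
  rcases eq_or_ne x η with rfl | hx
  · exact continuousAt_dslope_same.2 (H.hasDerivAt_s13 x).differentiableAt
  · exact (continuousAt_dslope_of_ne hx).2 H.continuous_s13.continuousAt

lemma continuous_log_dslope (H : IsZetaInverse_s13 t f) (η : ℝ) :
    Continuous fun x => Real.log (dslope t η x) :=
  (H.continuous_dslope η).log fun x => (H.dslope_pos η x).ne'

lemma dslope_symm (t : ℝ → ℝ) (η x : ℝ) : dslope t η x = dslope t x η := by
  rcases eq_or_ne x η with rfl | hx
  · rfl
  · rw [dslope_of_ne _ hx, dslope_of_ne _ hx.symm, slope_comm]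

variable {h : ℝ → ℝ → ℝ}

lemma hasDerivAt_log_dslope (H : IsZetaInverse_s13 t f) (hc : ∀ η, Continuous (h η))
    (hh : ∀ η x, x ≠ η → h η x = t x * f x / (t x - t η) - 1 / (x - η)) (η x : ℝ) :
    HasDerivAt (fun y => Real.log (dslope t η y)) (h η x) x := by
  have off : ∀ y, y ≠ η → HasDerivAt (fun y => Real.log (dslope t η y)) (h η y) y := by
    intro y hy
    have h1 : y - η ≠ 0 := sub_ne_zero.2 hy
    have h2 : t y - t η ≠ 0 := sub_ne_zero.2 (H.strictMono.injective.ne hy)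
    have hd : HasDerivAt (fun z => (t z - t η) / (z - η)) _ y :=
      ((H.hasDerivAt_s13 y).sub_const (t η)).div ((hasDerivAt_id y).sub_const η) h1
    have hl := hd.log (div_ne_zero h2 h1)
    rw [hh η y hy]
    refine HasDerivAt.congr_of_eventuallyEq (f := fun z => Real.log ((t z - t η) / (z - η))) ?_ ?_
    · refine hl.congr_deriv ?_
      field_simp
    · filter_upwards [isOpen_ne.mem_nhds hy] with z hz
      rw [dslope_of_ne _ hz, slope_def_field]
  rcases eq_or_ne x η with rfl | hx
  · exact hasDerivAt_of_hasDerivAt_of_ne off (H.continuous_log_dslope x).continuousAt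
      (hc x).continuousAt
  · exact off x hx

lemma kernel_bounds (H : IsZetaInverse_s13 t f) (hc : ∀ η, Continuous (h η))
    (hh : ∀ η x, x ≠ η → h η x = t x * f x / (t x - t η) - 1 / (x - η)) (η x : ℝ) :
    0 ≤ h η x ∧ h η x ≤ f x := by
  have hclosed : IsClosed {x | 0 ≤ h η x ∧ h η x ≤ f x} :=
    (isClosed_le continuous_const (hc η)).inter (isClosed_le (hc η) H.f_continuous)
  have hsub : closure {η}ᶜ ⊆ {x | 0 ≤ h η x ∧ h η x ≤ f x} := by
    refine closure_minimal (fun y hy => ?_) hclosed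
    change 0 ≤ h η y ∧ h η y ≤ f y
    rw [hh η y hy]
    exact H.diff_quot_bounds hy
  exact hsub (by rw [(dense_compl_singleton η).closure_eq]; trivial)

lemma abs_log_dslope_le (H : IsZetaInverse_s13 t f) (hc : ∀ η, Continuous (h η))
    (hh : ∀ η x, x ≠ η → h η x = t x * f x / (t x - t η) - 1 / (x - η)) (η x : ℝ) :
    |Real.log (dslope t η x)| ≤
      |Real.log (dslope t η η)| + |Real.log (t η)| + (1 + x ^ 2 / 2) := by
  have m1 : Monotone fun y => Real.log (dslope t η y) :=
    monotone_of_hasDerivAt_nonneg (H.hasDerivAt_log_dslope hc hh η)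
      fun y => (H.kernel_bounds hc hh η y).1
  have m2 : Monotone fun y => Real.log (t y) - Real.log (dslope t η y) :=
    monotone_of_hasDerivAt_nonneg
      (fun y => (H.hasDerivAt_log y).sub (H.hasDerivAt_log_dslope hc hh η y))
      fun y => sub_nonneg.2 (H.kernel_bounds hc hh η y).2
  have b := abs_le.1 (H.abs_log_le x)
  have l1 := le_abs_self (Real.log (dslope t η η))
  have l2 := neg_abs_le (Real.log (dslope t η η))
  have l3 := le_abs_self (Real.log (t η))
  have l4 := neg_abs_le (Real.log (t η))
  rw [abs_le]
  rcases le_total x η with hx | hx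
  · have a1 := m1 hx
    have a2 := m2 hx
    simp only at a1 a2
    constructor <;> nlinarith [sq_nonneg x]
  · have a1 := m1 hx
    have a2 := m2 hx
    simp only at a1 a2
    constructor <;> nlinarith [sq_nonneg x]

lemma kernel_combination (H : IsZetaInverse_s13 t f)
    (hh : ∀ η x, x ≠ η → h η x = t x * f x / (t x - t η) - 1 / (x - η)) {η x : ℝ}
    (hx : x ≠ η) : x * h x η + η * h η x = 1 - f η * f x := by
  rw [hh η x hx, hh x η hx.symm]
  have h1 : x - η ≠ 0 := sub_ne_zero.2 hx
  have h1' : η - x ≠ 0 := sub_ne_zero.2 hx.symm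
  have h2 : t x - t η ≠ 0 := sub_ne_zero.2 (H.strictMono.injective.ne hx)
  have e1 : 1 / (η - x) = -(1 / (x - η)) := by rw [← neg_sub, one_div, one_div, inv_neg]
  have e2 : t η * f η / (t η - t x) = -(t η * f η / (t x - t η)) := by
    rw [← neg_sub, div_neg]
  have e3 : (x * (t η * f η) - η * (t x * f x)) / (t x - t η) = f η * f x := by
    rw [div_eq_iff h2]
    linear_combination (-(t η * f η)) * H.f_mul x + t x * f x * H.f_mul η
  have e4 : (x - η) * (1 / (x - η)) = 1 := mul_one_div_cancel h1
  rw [e1, e2, ← e3]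
  linear_combination e4

end IsZetaInverse_s13

lemma integrable_exp_mul_of_abs_le {a C : ℝ} (ha : 0 < a) {φ : ℝ → ℝ}
    (hφ : AEStronglyMeasurable φ) (hb : ∀ᵐ x, |φ x| ≤ C * (1 + x ^ 4)) :
    Integrable fun x => Real.exp (-a * x ^ 2 / 2) * φ x := by
  have e : ∀ x : ℝ, Real.exp (-a * x ^ 2 / 2) = Real.exp (-(a / 2) * x ^ 2) := fun x => by
    congr 1; ring
  have i0 : Integrable fun x : ℝ => Real.exp (-(a / 2) * x ^ 2) :=
    integrable_exp_neg_mul_sq (half_pos ha)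
  have i4 : Integrable fun x : ℝ => x ^ 4 * Real.exp (-(a / 2) * x ^ 2) := by
    have := integrable_rpow_mul_exp_neg_mul_sq (half_pos ha) (s := 4) (by norm_num)
    refine this.congr (Filter.Eventually.of_forall fun x => ?_)
    simp only
    norm_cast
  refine ((i0.add i4).const_mul C).mono' ?_ ?_
  · exact (Continuous.aestronglyMeasurable (by fun_prop)).mul hφ
  · filter_upwards [hb] with x hx
    rw [norm_mul, Real.norm_eq_abs, Real.norm_eq_abs, Real.abs_exp, e]
    have := mul_le_mul_of_nonneg_left hx (Real.exp_pos (-(a / 2) * x ^ 2)).le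
    simp only [Pi.add_apply]
    linarith

namespace IsZetaInverse_s13

variable {t f : ℝ → ℝ} {h : ℝ → ℝ → ℝ} {a : ℝ}

lemma integrable_f (H : IsZetaInverse_s13 t f) (ha : 0 < a) :
    Integrable fun x => Real.exp (-a * x ^ 2 / 2) * f x := by
  refine integrable_exp_mul_of_abs_le (C := 4) ha H.f_continuous.aestronglyMeasurable
    (Filter.Eventually.of_forall fun x => ?_)
  rw [abs_of_pos (H.f_pos x)]
  nlinarith [H.f_le x, sq_nonneg (x ^ 2 - 1)]

lemma integrable_kernel (H : IsZetaInverse_s13 t f) (ha : 0 < a) (hc : ∀ η, Continuous (h η))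
    (hh : ∀ η x, x ≠ η → h η x = t x * f x / (t x - t η) - 1 / (x - η)) (η : ℝ) :
    Integrable fun x => Real.exp (-a * x ^ 2 / 2) * h η x := by
  refine integrable_exp_mul_of_abs_le (C := 4) ha (hc η).aestronglyMeasurable
    (Filter.Eventually.of_forall fun x => ?_)
  have hb := H.kernel_bounds hc hh η x
  rw [abs_of_nonneg hb.1]
  nlinarith [H.f_le x, sq_nonneg (x ^ 2 - 1)]

lemma integrable_log_dslope (H : IsZetaInverse_s13 t f) (ha : 0 < a) (hc : ∀ η, Continuous (h η))
    (hh : ∀ η x, x ≠ η → h η x = t x * f x / (t x - t η) - 1 / (x - η)) (η : ℝ) :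
    Integrable fun x => Real.exp (-a * x ^ 2 / 2) * Real.log (dslope t η x) := by
  set K := |Real.log (dslope t η η)| + |Real.log (t η)|
  have hK0 : 0 ≤ K := by positivity
  refine integrable_exp_mul_of_abs_le (C := K + 2) ha
    (H.continuous_log_dslope η).aestronglyMeasurable (Filter.Eventually.of_forall fun x => ?_)
  have hb := H.abs_log_dslope_le hc hh η x
  have : 0 ≤ K * x ^ 4 := by positivity
  nlinarith [sq_nonneg (x ^ 2 - 1)]

lemma integrable_mul_log_dslope (H : IsZetaInverse_s13 t f) (ha : 0 < a)
    (hc : ∀ η, Continuous (h η))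
    (hh : ∀ η x, x ≠ η → h η x = t x * f x / (t x - t η) - 1 / (x - η)) (η : ℝ) :
    Integrable fun x => Real.exp (-a * x ^ 2 / 2) * (x * Real.log (dslope t η x)) := by
  set K := |Real.log (dslope t η η)| + |Real.log (t η)|
  have hK0 : 0 ≤ K := by positivity
  refine integrable_exp_mul_of_abs_le (C := 2 * (K + 2)) ha
    (continuous_id.mul (H.continuous_log_dslope η)).aestronglyMeasurable
    (Filter.Eventually.of_forall fun x => ?_)
  have hb := H.abs_log_dslope_le hc hh η x
  have hx : |x| ≤ 1 + x ^ 2 := by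
    rw [abs_le]
    constructor <;> nlinarith [sq_nonneg (x - 1), sq_nonneg (x + 1)]
  rw [abs_mul]
  calc |x| * |Real.log (dslope t η x)| ≤ (1 + x ^ 2) * (K + (1 + x ^ 2 / 2)) :=
        mul_le_mul hx hb (abs_nonneg _) (by positivity)
    _ ≤ 2 * (K + 2) * (1 + x ^ 4) := by
        have h1 : 0 ≤ K * (x ^ 2 - 1) ^ 2 := by positivity
        have h2 : 0 ≤ K * x ^ 4 := by positivity
        have h3 : 0 ≤ x ^ 4 := by positivity
        nlinarith [sq_nonneg (x ^ 2 - 1)]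

lemma integral_kernel (H : IsZetaInverse_s13 t f) (ha : 0 < a) (hc : ∀ η, Continuous (h η))
    (hh : ∀ η x, x ≠ η → h η x = t x * f x / (t x - t η) - 1 / (x - η)) (η : ℝ) :
    ∫ x, Real.exp (-a * x ^ 2 / 2) * h η x =
      a * ∫ x, Real.exp (-a * x ^ 2 / 2) * (x * Real.log (dslope t η x)) := by
  have hu : ∀ x : ℝ, HasDerivAt (fun x : ℝ => Real.exp (-a * x ^ 2 / 2))
      (-(a * x) * Real.exp (-a * x ^ 2 / 2)) x := by
    intro x
    have h1 : HasDerivAt (fun x : ℝ => -a * x ^ 2 / 2) (-(a * x)) x := by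
      refine (((hasDerivAt_pow 2 x).const_mul (-a)).div_const 2).congr_deriv ?_
      push_cast
      ring
    refine h1.exp.congr_deriv ?_
    ring
  have hi := (H.integrable_mul_log_dslope ha hc hh η).const_mul (-a)
  rw [integral_mul_deriv_eq_deriv_mul_of_integrable (fun x _ => hu x)
    (fun x _ => H.hasDerivAt_log_dslope hc hh η x) (H.integrable_kernel ha hc hh η)
    (hi.congr (Filter.Eventually.of_forall fun x => by simp only [Pi.mul_apply]; ring))
    (H.integrable_log_dslope ha hc hh η), ← integral_const_mul, ← integral_neg]
  congr 1
  ext x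
  ring

lemma hasDerivAt_integral_kernel (H : IsZetaInverse_s13 t f) (ha : 0 < a)
    (hc : ∀ η, Continuous (h η))
    (hh : ∀ η x, x ≠ η → h η x = t x * f x / (t x - t η) - 1 / (x - η)) (η : ℝ) :
    Integrable (fun x => Real.exp (-a * x ^ 2 / 2) * (x * h x η)) ∧
    HasDerivAt (fun η => ∫ x, Real.exp (-a * x ^ 2 / 2) * h η x)
      (a * ∫ x, Real.exp (-a * x ^ 2 / 2) * (x * h x η)) η := by
  have hmeas : AEStronglyMeasurable fun x => h x η := by
    have hm : Measurable fun x => t η * f η / (t η - t x) - 1 / (η - x) :=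
      (measurable_const.div (measurable_const.sub H.continuous_s13.measurable)).sub
        (measurable_const.div (measurable_const.sub measurable_id))
    refine hm.aestronglyMeasurable.congr ?_
    filter_upwards [Measure.ae_ne volume η] with x hx
    exact (hh x η hx.symm).symm
  have hbound : Integrable fun x : ℝ => Real.exp (-a * x ^ 2 / 2) * (|x| * f (η - 1)) := by
    have hf := H.f_pos (η - 1)
    refine integrable_exp_mul_of_abs_le (C := 2 * f (η - 1)) ha
      (continuous_abs.mul continuous_const).aestronglyMeasurable
      (Filter.Eventually.of_forall fun x => ?_)
    rw [abs_mul, abs_abs, abs_of_pos hf]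
    have hx : |x| ≤ 2 * (1 + x ^ 4) := by
      rw [abs_le]
      constructor <;> nlinarith [sq_nonneg (x - 1), sq_nonneg (x + 1), sq_nonneg (x ^ 2 - 1)]
    nlinarith
  have key := hasDerivAt_integral_of_dominated_loc_of_deriv_le (𝕜 := ℝ) (μ := volume)
    (F := fun η x => Real.exp (-a * x ^ 2 / 2) * (x * Real.log (dslope t η x)))
    (F' := fun η x => Real.exp (-a * x ^ 2 / 2) * (x * h x η))
    (bound := fun x => Real.exp (-a * x ^ 2 / 2) * (|x| * f (η - 1)))
    (Ioi_mem_nhds (sub_one_lt η))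
    (Filter.Eventually.of_forall fun y =>
      (H.integrable_mul_log_dslope ha hc hh y).aestronglyMeasurable)
    (H.integrable_mul_log_dslope ha hc hh η)
    ((Continuous.aestronglyMeasurable (by fun_prop)).mul
      (continuous_id.aestronglyMeasurable.mul hmeas))
    (Filter.Eventually.of_forall fun x y hy => by
      have hb := H.kernel_bounds hc hh x y
      rw [norm_mul, norm_mul, Real.norm_eq_abs, Real.norm_eq_abs, Real.norm_eq_abs,
        Real.abs_exp, abs_of_nonneg hb.1]
      have := hb.2.trans (H.f_antitone (le_of_lt hy))
      gcongr)
    hbound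
    (Filter.Eventually.of_forall fun x y _ => by
      have := H.hasDerivAt_log_dslope hc hh x y
      simp_rw [dslope_symm t x] at this
      exact (this.const_mul x).const_mul _)
  refine ⟨key.1, ?_⟩
  simp_rw [H.integral_kernel ha hc hh]
  exact key.2.const_mul a

lemma integral_exp_mul_f (H : IsZetaInverse_s13 t f) (ha : 0 < a) :
    ∫ x, Real.exp (-a * x ^ 2 / 2) * f x = Real.exp a * a ^ (-a) * Real.Gamma a := by
  have himg : t '' Set.univ = Set.Ioi 0 := by
    ext s
    simp only [Set.image_univ, Set.mem_range, Set.mem_Ioi]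
    exact ⟨fun ⟨x, hx⟩ => hx ▸ H.pos x, H.surj s⟩
  have hcv := integral_image_eq_integral_abs_deriv_smul MeasurableSet.univ
    (fun x _ => (H.hasDerivAt_s13 x).hasDerivWithinAt) H.strictMono.injective.injOn
    (fun s => s ^ (a - 1) * Real.exp (-(a * s)))
  rw [himg, Real.integral_rpow_mul_exp_neg_mul_Ioi ha ha, setIntegral_univ] at hcv
  rw [one_div, Real.inv_rpow ha.le, ← Real.rpow_neg ha.le] at hcv
  rw [mul_assoc, hcv, ← integral_const_mul]
  congr 1
  ext x
  have hpos := H.pos x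
  rw [abs_of_pos (mul_pos hpos (H.f_pos x)), smul_eq_mul]
  have e1 : t x * t x ^ (a - 1) = Real.exp (a * Real.log (t x)) := by
    rw [mul_comm a, ← Real.rpow_def_of_pos hpos, Real.rpow_sub_one hpos.ne']
    field_simp
  have e2 : Real.exp (-a * x ^ 2 / 2)
      = Real.exp a * Real.exp (a * Real.log (t x)) * Real.exp (-(a * t x)) := by
    rw [← Real.exp_add, ← Real.exp_add, H.sq x]
    congr 1
    ring
  rw [e2, ← e1]
  ring

end IsZetaInverse_s13

/-- The function `s ↦ sign (s - 1) * √(2 * (s - log s - 1))` is monotone on the positive reals. -/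
lemma sign_mul_sqrt_le {s r : ℝ} (hs : 0 < s) (hsr : s ≤ r) :
    Real.sign (s - 1) * Real.sqrt (2 * (s - Real.log s - 1)) ≤
      Real.sign (r - 1) * Real.sqrt (2 * (r - Real.log r - 1)) := by
  have hr : 0 < r := hs.trans_le hsr
  have hlog : Real.log (r / s) = Real.log r - Real.log s := Real.log_div hr.ne' hs.ne'
  have sign_nonneg : ∀ u : ℝ, 1 < u → Real.sign (u - 1) = 1 := fun u hu =>
    Real.sign_of_pos (by linarith)
  have sign_nonpos : ∀ u : ℝ, u < 1 → Real.sign (u - 1) = -1 := fun u hu =>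
    Real.sign_of_neg (by linarith)
  rcases lt_trichotomy s 1 with h1 | rfl | h1
  · rcases lt_or_ge r 1 with h2 | h2
    · rw [sign_nonpos s h1, sign_nonpos r h2, neg_one_mul, neg_one_mul, neg_le_neg_iff]
      refine Real.sqrt_le_sqrt ?_
      have h3 := Real.one_sub_inv_le_log_of_pos (div_pos hr hs)
      rw [hlog, inv_div] at h3
      have h4 : r - s ≤ 1 - s / r := by
        rw [one_sub_div hr.ne', le_div_iff₀ hr]
        nlinarith
      linarith
    · rw [sign_nonpos s h1]
      have h3 : 0 ≤ Real.sign (r - 1) := by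
        rcases h2.eq_or_lt with rfl | h2
        · simp
        · rw [sign_nonneg r h2]; exact zero_le_one
      have := mul_nonneg h3 (Real.sqrt_nonneg (2 * (r - Real.log r - 1)))
      linarith [Real.sqrt_nonneg (2 * (s - Real.log s - 1))]
  · rcases hsr.eq_or_lt with rfl | h2
    · exact le_rfl
    · rw [sign_nonneg r h2]
      simp
  · have h2 : 1 < r := h1.trans_le hsr
    rw [sign_nonneg s h1, sign_nonneg r h2, one_mul, one_mul]
    refine Real.sqrt_le_sqrt ?_
    have h3 := Real.log_le_sub_one_of_pos (div_pos hr hs)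
    rw [hlog] at h3
    have h4 : r / s - 1 ≤ r - s := by
      rw [div_sub_one hs.ne', div_le_iff₀ hs]
      nlinarith
    linarith

lemma sq_sign_mul_sqrt {s : ℝ} (hs : 0 < s) :
    (Real.sign (s - 1) * Real.sqrt (2 * (s - Real.log s - 1))) ^ 2 =
      2 * (s - Real.log s - 1) := by
  have h0 : 0 ≤ 2 * (s - Real.log s - 1) := by linarith [Real.log_le_sub_one_of_pos hs]
  rw [mul_pow, Real.sq_sqrt h0]
  rcases eq_or_ne s 1 with rfl | h1
  · simp
  · rcases Real.sign_apply_eq_of_ne_zero (s - 1) (sub_ne_zero.2 h1) with h | h <;>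
      rw [h] <;> ring

/-- Regularity at the origin of the logarithmic derivative follows from that of `t f ^ 2`. -/
lemma continuousAt_zero_of_mul_sq {t f G : ℝ → ℝ} (ht : ContinuousAt t 0) (ht0 : t 0 = 1)
    (hf0 : f 0 = 1) (hf : ∀ x, 0 ≤ f x) (hG : ContinuousAt G 0) (hG0 : G 0 = 1)
    (hGf : ∀ x, x ≠ 0 → G x = t x * f x ^ 2) (htpos : ∀ x, 0 < t x) : ContinuousAt f 0 := by
  have h1 : ContinuousAt (fun x => Real.sqrt (G x / t x)) 0 :=
    (hG.div ht (htpos 0).ne').sqrt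
  refine h1.congr (Filter.Eventually.of_forall fun x => ?_)
  rcases eq_or_ne x 0 with rfl | hx
  · simp [hG0, ht0, hf0]
  · change √(G x / t x) = f x
    rw [hGf x hx, mul_div_cancel_left₀ _ (htpos x).ne', Real.sqrt_sq (hf x)]

/-- Fix real `a > 0`. With `ζ(t) = sign(t-1)√(2(t - ln t - 1))` (a strictly increasing
bijection of `(0,∞)` onto `ℝ`, inverse `t(·)`), for each `η` let `λ = t(η)`,
`g_η(ζ) = ζ t(ζ)(ζ-η)/((t(ζ)-1)(t(ζ)-λ))` extended continuously (`g_η(η)=1`),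
`h_η(ζ) = (g_η(ζ)-1)/(ζ-η)` extended continuously at `η`, and
`T_a(η) = -√(a/(2π)) ∫_{-∞}^{∞} e^(-aζ²/2) h_η(ζ) dζ`. Then `η ↦ T_a(η)` is
differentiable and `T_a′(η) + aη T_a(η) = a(f(η) Γ*(a) - 1)`, where `f(η) = η/(λ-1)`
(`f(0) = 1`) and `Γ*(a) = √(a/(2π)) e^a a^(-a) Γ(a)`. -/
theorem T_differential_equation (a : ℝ) (ha : 0 < a)
    (zeta : ℝ → ℝ)
    (hzeta : ∀ s : ℝ, zeta s = Real.sign (s - 1) * Real.sqrt (2 * (s - Real.log s - 1)))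
    (tinv : ℝ → ℝ) (htinv_pos : ∀ x : ℝ, 0 < tinv x)
    (htinv_left : ∀ s : ℝ, 0 < s → tinv (zeta s) = s)
    (htinv_right : ∀ x : ℝ, zeta (tinv x) = x)
    (g : ℝ → ℝ → ℝ) (hg_cont : ∀ η : ℝ, Continuous (g η))
    (hg : ∀ η x : ℝ, x ≠ 0 → x ≠ η →
      g η x = x * tinv x * (x - η) / ((tinv x - 1) * (tinv x - tinv η)))
    (hgη : ∀ η : ℝ, g η η = 1)
    (h : ℝ → ℝ → ℝ) (hh_cont : ∀ η : ℝ, Continuous (h η))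
    (hh : ∀ η x : ℝ, x ≠ η → h η x = (g η x - 1) / (x - η))
    (T : ℝ → ℝ)
    (hT : ∀ η : ℝ, T η =
      -Real.sqrt (a / (2 * Real.pi)) * ∫ x : ℝ, Real.exp (-a * x ^ 2 / 2) * h η x)
    (f : ℝ → ℝ) (hf0 : f 0 = 1) (hf : ∀ η : ℝ, η ≠ 0 → f η = η / (tinv η - 1)) :
    Differentiable ℝ T ∧
    ∀ η : ℝ, deriv T η + a * η * T η =
      a * (f η * (Real.sqrt (a / (2 * Real.pi)) * Real.exp a * a ^ (-a) * Real.Gamma a) - 1) := by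
  have zmono : ∀ s r : ℝ, 0 < s → s ≤ r → zeta s ≤ zeta r := fun s r hs hsr => by
    rw [hzeta, hzeta]
    exact sign_mul_sqrt_le hs hsr
  have z1 : zeta 1 = 0 := by simp [hzeta]
  have t0 : tinv 0 = 1 := by rw [← z1, htinv_left 1 one_pos]
  have tmono : StrictMono tinv := fun x y hxy => by
    by_contra hcon
    have := zmono _ _ (htinv_pos y) (not_lt.1 hcon)
    rw [htinv_right, htinv_right] at this
    linarith
  have tsurj : ∀ s, 0 < s → ∃ x, tinv x = s := fun s hs => ⟨zeta s, htinv_left s hs⟩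
  have tcont : Continuous tinv := continuous_of_strictMono_of_surj_pos htinv_pos tmono tsurj
  have tne : ∀ x, x ≠ 0 → tinv x - 1 ≠ 0 := fun x hx =>
    sub_ne_zero.2 (t0 ▸ tmono.injective.ne hx)
  have fmul : ∀ x, f x * (tinv x - 1) = x := fun x => by
    rcases eq_or_ne x 0 with rfl | hx
    · simp [t0]
    · rw [hf x hx, div_mul_cancel₀ _ (tne x hx)]
  have fnonneg : ∀ x, 0 ≤ f x := fun x => by
    rcases lt_trichotomy x 0 with hx | rfl | hx
    · rw [hf x hx.ne]
      exact div_nonneg_of_nonpos hx.le (by linarith [tmono hx])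
    · rw [hf0]; exact zero_le_one
    · rw [hf x hx.ne']
      exact div_nonneg hx.le (by linarith [tmono hx])
  have H : IsZetaInverse_s13 tinv f :=
    { pos := htinv_pos
      sq := fun x => by
        rw [← sq_sign_mul_sqrt (htinv_pos x), ← hzeta, htinv_right]
      strictMono := tmono
      surj := tsurj
      f_mul := fmul
      f_zero := hf0
      f_continuousAt := by
        refine continuousAt_zero_of_mul_sq tcont.continuousAt t0 hf0 fnonneg
          (hg_cont 0).continuousAt (hgη 0) (fun x hx => ?_) htinv_pos
        rw [hg 0 x hx hx, t0, hf x hx]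
        have := tne x hx
        field_simp
        ring }
  have tsub : ∀ η x, x ≠ η → tinv x - tinv η ≠ 0 := fun η x hx =>
    sub_ne_zero.2 (tmono.injective.ne hx)
  have hgf : ∀ η x, x ≠ η → g η x = tinv x * f x * (x - η) / (tinv x - tinv η) := by
    intro η x hx
    have off : ∀ y, y ≠ 0 → y ≠ η →
        g η y = tinv y * f y * (y - η) / (tinv y - tinv η) := fun y hy0 hy => by
      have h1 := tne y hy0
      have h2 := tsub η y hy
      rw [hg η y hy0 hy, hf y hy0]
      field_simp
    rcases eq_or_ne x 0 with rfl | hx0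
    · have c1 : ContinuousAt (fun y => tinv y * f y * (y - η) / (tinv y - tinv η)) 0 :=
        ((tcont.mul H.f_continuous).mul (continuous_id.sub continuous_const)).continuousAt.div
          (tcont.sub continuous_const).continuousAt (tsub η 0 hx)
      have e : g η =ᶠ[nhdsWithin 0 {0}ᶜ]
          fun y => tinv y * f y * (y - η) / (tinv y - tinv η) := by
        filter_upwards [self_mem_nhdsWithin,
          nhdsWithin_le_nhds (isOpen_ne.mem_nhds hx)] with y hy0 hy using off y hy0 hy
      exact tendsto_nhds_unique ((hg_cont η).continuousAt.tendsto.mono_left nhdsWithin_le_nhds)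
        ((c1.tendsto.mono_left nhdsWithin_le_nhds).congr' e.symm)
    · exact off x hx0 hx
  have hker : ∀ η x, x ≠ η → h η x = tinv x * f x / (tinv x - tinv η) - 1 / (x - η) := by
    intro η x hx
    have h1 := tsub η x hx
    have h2 : x - η ≠ 0 := sub_ne_zero.2 hx
    rw [hh η x hx, hgf η x hx]
    field_simp
  have hTd : ∀ η, HasDerivAt T (-Real.sqrt (a / (2 * Real.pi)) *
      (a * ∫ x, Real.exp (-a * x ^ 2 / 2) * (x * h x η))) η := fun η => by
    rw [funext hT]
    exact (H.hasDerivAt_integral_kernel ha hh_cont hker η).2.const_mul _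
  refine ⟨fun η => (hTd η).differentiableAt, fun η => ?_⟩
  rw [(hTd η).deriv, hT η]
  have i1 := (H.hasDerivAt_integral_kernel ha hh_cont hker η).1
  have i2 := (H.integrable_kernel ha hh_cont hker η).const_mul η
  have hexp : ∀ x : ℝ, Real.exp (-a * x ^ 2 / 2) = Real.exp (-(a / 2) * x ^ 2) := fun x => by
    congr 1; ring
  have i3 : Integrable fun x : ℝ => Real.exp (-a * x ^ 2 / 2) := by
    simp_rw [hexp]
    exact integrable_exp_neg_mul_sq (half_pos ha)
  have i4 := (H.integrable_f ha).const_mul (f η)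
  have hgauss : Real.sqrt (a / (2 * Real.pi)) * ∫ x : ℝ, Real.exp (-a * x ^ 2 / 2) = 1 := by
    simp_rw [hexp]
    rw [integral_gaussian, ← Real.sqrt_mul (by positivity)]
    have : a / (2 * Real.pi) * (Real.pi / (a / 2)) = 1 := by
      have := Real.pi_pos
      field_simp
    rw [this, Real.sqrt_one]
  have hsum : (∫ x, Real.exp (-a * x ^ 2 / 2) * (x * h x η)) +
      η * ∫ x, Real.exp (-a * x ^ 2 / 2) * h η x =
      (∫ x, Real.exp (-a * x ^ 2 / 2)) - f η * (Real.exp a * a ^ (-a) * Real.Gamma a) := by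
    rw [← H.integral_exp_mul_f ha, ← integral_const_mul, ← integral_const_mul,
      ← integral_add i1 i2, ← integral_sub i3 i4]
    refine integral_congr_ae ?_
    filter_upwards [Measure.ae_ne volume η] with x hx
    linear_combination Real.exp (-a * x ^ 2 / 2) * H.kernel_combination hker hx
  linear_combination (-a * Real.sqrt (a / (2 * Real.pi))) * hsum - a * hgauss
end
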